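/- Let Ω ⊂ ℝ² be a Jordan domain with analytic boundary and let f⁽⁰⁾ : Ω̄ → ℝ be a C^{2+1/2} function with f⁽⁰⁾_xx·f⁽⁰⁾_yy − (f⁽⁰⁾_xy)² ≠ 0 everywhere on Ω̄ and with vanishing normalized mean curvature H⁽⁰⁾ = 0, and let f⁽ᵐ⁾ (m ≥ 1) be the unique C^{2+1/2} functions vanishing on ∂Ω satisfying the recursive equations H₀(f⁽ᵐ⁾) = −Σ_{r=1}^{m−1} C(m, r)·H_r(f⁽ᵐ⁻ʳ⁾) + [ −m·K⁽ᵐ⁻¹⁾ − (4/(m+1))·Σ_{r=2}^{m−1} C(m+1, r)·H⁽ʳ⁾·H⁽ᵐ⁻ʳ⁺¹⁾ ] / ( 2^{1−δ_{m1}}·√(−K⁽⁰⁾) ). Let C(Ω, f⁽⁰⁾) > 0 be any constant for which the bound ‖f⁽ᵐ⁾‖ ≤ C(Ω, f⁽⁰⁾)·( Σ_{p₁+p₂+p₃ = m, 0 ≤ pᵢ < m} (m!/(p₁!p₂!p₃!))·∏‖f⁽ᵖⁱ⁾‖ + m·Σ_{q₁+⋯+q₄ = m−1, qᵢ ≥ 0}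 ((m−1)!/(q₁!⋯q₄!))·∏‖f⁽qᵢ⁾‖ + (1/(m+1))·Σ_{r₁+⋯+r₆ = m+1, 0 ≤ rᵢ < m} ((m+1)!/(r₁!⋯r₆!))·∏‖f⁽rᵢ⁾‖ ) holds for all m ≥ 1, and let a⁽ᵐ⁾(M, N) be defined by a⁽⁰⁾ = M and the analogous recursion a⁽ᵐ⁾ = N·Σ_{p} (m!/(p₁!p₂!p₃!))∏a⁽ᵖⁱ⁾ + N·m·Σ_{q} ((m−1)!/(q₁!⋯q₄!))∏a⁽qᵢ⁾ + (N/(m+1))·Σ_{r} ((m+1)!/(r₁!⋯r₆!))∏a⁽rᵢ⁾. Then ‖f⁽ᵐ⁾‖ ≤ a⁽ᵐ⁾( ‖f⁽⁰⁾‖, C(Ω, f⁽⁰⁾) ) for every m ≥ 0; consequently, there exists ε > 0 such that the series Σ_{m≥0} f⁽ᵐ⁾·tᵐ/m! converges in the C^{2+1/2} norm for all |t| < ε and its sum satisfies the Euclidean CRPC equation with parameter t on Ω. -/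

import Mathlib

open Set Filter
open scoped BigOperators Topology

noncomputable section

/-- Partial derivative in the first variable. -/
def pdx (f : ℝ × ℝ → ℝ) (p : ℝ × ℝ) : ℝ := deriv (fun s : ℝ => f (s, p.2)) p.1

/-- Partial derivative in the second variable. -/
def pdy (f : ℝ × ℝ → ℝ) (p : ℝ × ℝ) : ℝ := deriv (fun s : ℝ => f (p.1, s)) p.2

/-- Second partial derivatives. -/
def fxx (f : ℝ × ℝ → ℝ) : ℝ × ℝ → ℝ := pdx (pdx f)
def fxy (f : ℝ × ℝ → ℝ) : ℝ × ℝ → ℝ := pdy (pdx f)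
def fyy (f : ℝ × ℝ → ℝ) : ℝ × ℝ → ℝ := pdy (pdy f)

/-- An analytic Jordan curve: image of a periodic injective real analytic map with
nowhere vanishing derivative. -/
def IsAnalyticJordanCurve {E : Type*} [NormedAddCommGroup E] [NormedSpace ℝ E]
    (Γ : Set E) : Prop :=
  ∃ (γ : ℝ → E) (T : ℝ), 0 < T ∧
    AnalyticOnNhd ℝ γ univ ∧
    (∀ s, γ (s + T) = γ s) ∧
    InjOn γ (Ico 0 T) ∧
    (∀ s, deriv γ s ≠ 0) ∧
    Γ = range γ

/-- A Jordan domain with analytic boundary. -/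
def IsAnalyticJordanDomain (Ω : Set (ℝ × ℝ)) : Prop :=
  IsOpen Ω ∧ Bornology.IsBounded Ω ∧ IsConnected Ω ∧ IsAnalyticJordanCurve (frontier Ω)

/-- `f` is real analytic in the closed set `s` : it agrees on `s` with a function
analytic on an open neighborhood of `s`. -/
def AnalyticOnClosed {E : Type*} [NormedAddCommGroup E] [NormedSpace ℝ E]
    (f : E → ℝ) (s : Set E) : Prop :=
  ∃ (U : Set E) (g : E → ℝ), IsOpen U ∧ s ⊆ U ∧ AnalyticOnNhd ℝ g U ∧ EqOn f g s

/-- The isotropic CRPC equation with parameter `t` at a point. -/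
def IsotropicCRPCAt (t : ℝ) (f : ℝ × ℝ → ℝ) (p : ℝ × ℝ) : Prop :=
  fxx f p + fyy f p = t * Real.sqrt ((fxy f p) ^ 2 - fxx f p * fyy f p)

/-- The Euclidean CRPC equation with parameter `t` at a point. -/
def EuclideanCRPCAt (t : ℝ) (f : ℝ × ℝ → ℝ) (p : ℝ × ℝ) : Prop :=
  (1 + (pdy f p) ^ 2) * fxx f p - 2 * pdx f p * pdy f p * fxy f p
      + (1 + (pdx f p) ^ 2) * fyy f p
    = t * Real.sqrt ((1 + (pdx f p) ^ 2 + (pdy f p) ^ 2)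
        * ((fxy f p) ^ 2 - fxx f p * fyy f p))

/-- Hölder condition with exponent 1/2 on a set. -/
def HolderHalfOn (g : ℝ × ℝ → ℝ) (s : Set (ℝ × ℝ)) : Prop :=
  ∃ C : ℝ, ∀ u ∈ s, ∀ v ∈ s, |g u - g v| ≤ C * ‖u - v‖ ^ ((1 : ℝ) / 2)

def C0norm (g : ℝ × ℝ → ℝ) (s : Set (ℝ × ℝ)) : ℝ := sSup ((fun p => |g p|) '' s)

def holderSemi (g : ℝ × ℝ → ℝ) (s : Set (ℝ × ℝ)) : ℝ :=
  sSup {r : ℝ | ∃ u ∈ s, ∃ v ∈ s, u ≠ v ∧ r = |g u - g v| / ‖u - v‖ ^ ((1 : ℝ) / 2)}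

/-- The `C^{1/2}` Hölder norm. -/
def ChalfNorm (g : ℝ × ℝ → ℝ) (s : Set (ℝ × ℝ)) : ℝ := C0norm g s + holderSemi g s

/-- The `C²` norm. -/
def C2norm (f : ℝ × ℝ → ℝ) (s : Set (ℝ × ℝ)) : ℝ :=
  C0norm f s + max (C0norm (pdx f) s) (C0norm (pdy f) s)
    + max (C0norm (fxx f) s) (max (C0norm (fxy f) s) (C0norm (fyy f) s))

/-- The `C^{2+1/2}` Hölder norm. -/
def C2halfNorm (f : ℝ × ℝ → ℝ) (s : Set (ℝ × ℝ)) : ℝ :=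
  C2norm f s + max (holderSemi (fxx f) s) (max (holderSemi (fxy f) s) (holderSemi (fyy f) s))

/-- Membership in the class `C^{1/2}` on `Ω̄`. -/
def IsCHalf (g : ℝ × ℝ → ℝ) (Ω : Set (ℝ × ℝ)) : Prop :=
  ContinuousOn g (closure Ω) ∧ HolderHalfOn g Ω

/-- Membership in the class `C^{2+1/2}` on `Ω̄`. -/
def IsC2Half (f : ℝ × ℝ → ℝ) (Ω : Set (ℝ × ℝ)) : Prop :=
  ContDiffOn ℝ 2 f Ω ∧
  ContinuousOn f (closure Ω) ∧ ContinuousOn (pdx f) (closure Ω) ∧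
  ContinuousOn (pdy f) (closure Ω) ∧ ContinuousOn (fxx f) (closure Ω) ∧
  ContinuousOn (fxy f) (closure Ω) ∧ ContinuousOn (fyy f) (closure Ω) ∧
  HolderHalfOn (fxx f) Ω ∧ HolderHalfOn (fxy f) Ω ∧ HolderHalfOn (fyy f) Ω

/-- `C^∞` up to the boundary. -/
def IsCInftyClosed (f : ℝ × ℝ → ℝ) (Ω : Set (ℝ × ℝ)) : Prop :=
  ContDiffOn ℝ (⊤ : ℕ∞) f Ω ∧ ∀ i j : ℕ, ContinuousOn (pdx^[i] (pdy^[j] f)) (closure Ω)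

/-- Right-hand side of the recursive Poisson equation (isotropic case). -/
def poissonRHS (f : ℕ → ℝ × ℝ → ℝ) (m : ℕ) (p : ℝ × ℝ) : ℝ :=
  ((m : ℝ) * ∑ r ∈ Finset.range m, ((m - 1).choose r : ℝ) *
      (fxy (f r) p * fxy (f (m - r - 1)) p - fxx (f r) p * fyy (f (m - r - 1)) p)
    - (1 / ((m : ℝ) + 1)) * ∑ r ∈ Finset.Icc 2 (m - 1), ((m + 1).choose r : ℝ) *
      (fxx (f r) p + fyy (f r) p) * (fxx (f (m - r + 1)) p + fyy (f (m - r + 1)) p))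
  / ((2 : ℝ) ^ (1 - (if m = 1 then 1 else 0) : ℕ) *
      Real.sqrt ((fxy (f 0) p) ^ 2 - fxx (f 0) p * fyy (f 0) p))

/-- `C²`-convergence on `Ω` at parameter `t` of the series with terms `f m · t^m/m!`
to the function `F`. -/
def C2ConvergesTo (f : ℕ → ℝ × ℝ → ℝ) (Ω : Set (ℝ × ℝ)) (t : ℝ) (F : ℝ × ℝ → ℝ) : Prop :=
  TendstoUniformlyOn
    (fun n p => ∑ m ∈ Finset.range n, f m p * t ^ m / (m.factorial : ℝ)) F atTop Ω ∧
  TendstoUniformlyOn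
    (fun n p => ∑ m ∈ Finset.range n, pdx (f m) p * t ^ m / (m.factorial : ℝ)) (pdx F) atTop Ω ∧
  TendstoUniformlyOn
    (fun n p => ∑ m ∈ Finset.range n, pdy (f m) p * t ^ m / (m.factorial : ℝ)) (pdy F) atTop Ω ∧
  TendstoUniformlyOn
    (fun n p => ∑ m ∈ Finset.range n, fxx (f m) p * t ^ m / (m.factorial : ℝ)) (fxx F) atTop Ω ∧
  TendstoUniformlyOn
    (fun n p => ∑ m ∈ Finset.range n, fxy (f m) p * t ^ m / (m.factorial : ℝ)) (fxy F) atTop Ω ∧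
  TendstoUniformlyOn
    (fun n p => ∑ m ∈ Finset.range n, fyy (f m) p * t ^ m / (m.factorial : ℝ)) (fyy F) atTop Ω


/-- `(1 + f_y²)⁽ʳ⁾` computed by the Leibniz rule from the sequence `f`. -/
def fy2r (f : ℕ → ℝ × ℝ → ℝ) (r : ℕ) (p : ℝ × ℝ) : ℝ :=
  (if r = 0 then 1 else 0) +
    ∑ i ∈ Finset.range (r + 1), (r.choose i : ℝ) * pdy (f i) p * pdy (f (r - i)) p

/-- `(f_x f_y)⁽ʳ⁾` computed by the Leibniz rule from the sequence `f`. -/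
def fxfyr (f : ℕ → ℝ × ℝ → ℝ) (r : ℕ) (p : ℝ × ℝ) : ℝ :=
  ∑ i ∈ Finset.range (r + 1), (r.choose i : ℝ) * pdx (f i) p * pdy (f (r - i)) p

/-- `(1 + f_x²)⁽ʳ⁾` computed by the Leibniz rule from the sequence `f`. -/
def fx2r (f : ℕ → ℝ × ℝ → ℝ) (r : ℕ) (p : ℝ × ℝ) : ℝ :=
  (if r = 0 then 1 else 0) +
    ∑ i ∈ Finset.range (r + 1), (r.choose i : ℝ) * pdx (f i) p * pdx (f (r - i)) p

/-- `H⁽ⁿ⁾`: the `n`-th derivative at `t = 0` of the normalized mean curvature,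
computed formally by the Leibniz rule from the sequence `f`. -/
def Hseq (f : ℕ → ℝ × ℝ → ℝ) (n : ℕ) (p : ℝ × ℝ) : ℝ :=
  (1 / 2) * ∑ r ∈ Finset.range (n + 1), (n.choose r : ℝ) *
    (fy2r f r p * fxx (f (n - r)) p - 2 * fxfyr f r p * fxy (f (n - r)) p
      + fx2r f r p * fyy (f (n - r)) p)

/-- `(1 + f_x² + f_y²)⁽ʳ⁾` computed by the Leibniz rule from the sequence `f`. -/
def gradSqr (f : ℕ → ℝ × ℝ → ℝ) (r : ℕ) (p : ℝ × ℝ) : ℝ :=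
  (if r = 0 then 1 else 0) +
    ∑ i ∈ Finset.range (r + 1), (r.choose i : ℝ) *
      (pdx (f i) p * pdx (f (r - i)) p + pdy (f i) p * pdy (f (r - i)) p)

/-- `(f_xy² - f_xx f_yy)⁽ˢ⁾` computed by the Leibniz rule from the sequence `f`. -/
def hessDiscr (f : ℕ → ℝ × ℝ → ℝ) (s : ℕ) (p : ℝ × ℝ) : ℝ :=
  ∑ i ∈ Finset.range (s + 1), (s.choose i : ℝ) *
    (fxy (f i) p * fxy (f (s - i)) p - fxx (f i) p * fyy (f (s - i)) p)

/-- `K⁽ⁿ⁾`: the `n`-th derivative at `t = 0` of the normalized Gaussian curvature,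
computed formally by the Leibniz rule from the sequence `f`. -/
def Kseq (f : ℕ → ℝ × ℝ → ℝ) (n : ℕ) (p : ℝ × ℝ) : ℝ :=
  -∑ r ∈ Finset.range (n + 1), (n.choose r : ℝ) * gradSqr f r p * hessDiscr f (n - r) p

/-- The linear differential operator `H_r` associated with the sequence `f`. -/
def Hop (f : ℕ → ℝ × ℝ → ℝ) (r : ℕ) (u : ℝ × ℝ → ℝ) (p : ℝ × ℝ) : ℝ :=
  fy2r f r p * fxx u p - 2 * fxfyr f r p * fxy u p + fx2r f r p * fyy u p
  + (2 : ℝ) ^ ((if r = 0 then 1 else 0) : ℕ) *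
      (fyy (f 0) p * pdx (f r) p - fxy (f 0) p * pdy (f r) p) * pdx u p
  + (2 : ℝ) ^ ((if r = 0 then 1 else 0) : ℕ) *
      (fxx (f 0) p * pdy (f r) p - fxy (f 0) p * pdx (f r) p) * pdy u p

/-- Right-hand side of the recursive linear elliptic equation (Euclidean case). -/
def ellipticRHS (f : ℕ → ℝ × ℝ → ℝ) (m : ℕ) (p : ℝ × ℝ) : ℝ :=
  -∑ r ∈ Finset.Icc 1 (m - 1), (m.choose r : ℝ) * Hop f r (f (m - r)) p
  + (-(m : ℝ) * Kseq f (m - 1) p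
      - 4 / ((m : ℝ) + 1) * ∑ r ∈ Finset.Icc 2 (m - 1), ((m + 1).choose r : ℝ) *
          Hseq f r p * Hseq f (m - r + 1) p)
    / ((2 : ℝ) ^ (1 - (if m = 1 then 1 else 0) : ℕ) * Real.sqrt (-Kseq f 0 p))

/-- `Σ_{p₁+p₂+p₃ = m, 0 ≤ pᵢ < m} m!/(p₁!p₂!p₃!) · b p₁ · b p₂ · b p₃`. -/
def multinom3Sum (b : ℕ → ℝ) (m : ℕ) : ℝ :=
  ∑ p ∈ (Finset.range m ×ˢ Finset.range m ×ˢ Finset.range m).filter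
      (fun p => p.1 + p.2.1 + p.2.2 = m),
    ((m.factorial : ℝ) /
        ((p.1.factorial : ℝ) * (p.2.1.factorial : ℝ) * (p.2.2.factorial : ℝ))) *
      (b p.1 * b p.2.1 * b p.2.2)

/-- `Σ_{q₁+q₂+q₃+q₄ = m-1, qᵢ ≥ 0} (m-1)!/(q₁!q₂!q₃!q₄!) · ∏ b qᵢ` (for `m ≥ 1`). -/
def multinom4Sum (b : ℕ → ℝ) (m : ℕ) : ℝ :=
  ∑ q ∈ (Finset.range m ×ˢ Finset.range m ×ˢ Finset.range m ×ˢ Finset.range m).filter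
      (fun q => q.1 + q.2.1 + q.2.2.1 + q.2.2.2 = m - 1),
    (((m - 1).factorial : ℝ) /
        ((q.1.factorial : ℝ) * (q.2.1.factorial : ℝ) * (q.2.2.1.factorial : ℝ) *
          (q.2.2.2.factorial : ℝ))) *
      (b q.1 * b q.2.1 * b q.2.2.1 * b q.2.2.2)

/-- `Σ_{r₁+⋯+r₆ = m+1, 0 ≤ rᵢ < m} (m+1)!/(r₁!⋯r₆!) · ∏ b rᵢ`. -/
def multinom6Sum (b : ℕ → ℝ) (m : ℕ) : ℝ :=
  ∑ r ∈ (Finset.range m ×ˢ Finset.range m ×ˢ Finset.range m ×ˢ Finset.range m ×ˢ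
      Finset.range m ×ˢ Finset.range m).filter
      (fun r => r.1 + r.2.1 + r.2.2.1 + r.2.2.2.1 + r.2.2.2.2.1 + r.2.2.2.2.2 = m + 1),
    (((m + 1).factorial : ℝ) /
        ((r.1.factorial : ℝ) * (r.2.1.factorial : ℝ) * (r.2.2.1.factorial : ℝ) *
          (r.2.2.2.1.factorial : ℝ) * (r.2.2.2.2.1.factorial : ℝ) *
          (r.2.2.2.2.2.factorial : ℝ))) *
      (b r.1 * b r.2.1 * b r.2.2.1 * b r.2.2.2.1 * b r.2.2.2.2.1 * b r.2.2.2.2.2)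


lemma aux_cover {ι : Type*} [DecidableEq ι] (P : Finset ι) (I : Finset ℕ) (T : ℕ → Finset ι)
    (key : ι → ℕ) (g : ι → ℝ) (hg : ∀ x ∈ P, 0 ≤ g x) (hT : ∀ m ∈ I, T m ⊆ P)
    (hk : ∀ m ∈ I, ∀ x ∈ T m, key x = m) :
    ∑ m ∈ I, ∑ x ∈ T m, g x ≤ ∑ x ∈ P, g x := by
  rw [← Finset.sum_biUnion]
  · apply Finset.sum_le_sum_of_subset_of_nonneg
    · intro x hx
      simp only [Finset.mem_biUnion] at hx
      obtain ⟨m, hm, hx⟩ := hx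
      exact hT m hm hx
    · intro x hx _
      exact hg x hx
  · intro m hm m' hm' hne
    simp only [Function.onFun]
    rw [Finset.disjoint_left]
    intro x hx hx'
    exact hne ((hk m hm x hx).symm.trans (hk m' hm' x hx'))

lemma multinom3_mono {b c : ℕ → ℝ} {m : ℕ} (hb : ∀ k < m, 0 ≤ b k) (hbc : ∀ k < m, b k ≤ c k) :
    multinom3Sum b m ≤ multinom3Sum c m := by
  unfold multinom3Sum
  apply Finset.sum_le_sum
  intro x hx
  simp only [Finset.mem_filter, Finset.mem_product, Finset.mem_range] at hx
  obtain ⟨⟨h1, h2, h3⟩, -⟩ := hx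
  have := hb _ h1
  have := hb _ h2
  have := hb _ h3
  have := hbc _ h1
  have := hbc _ h2
  have := hbc _ h3
  have : 0 ≤ c x.1 := by linarith
  have : 0 ≤ c x.2.1 := by linarith
  gcongr

lemma multinom4_mono {b c : ℕ → ℝ} {m : ℕ} (hb : ∀ k < m, 0 ≤ b k) (hbc : ∀ k < m, b k ≤ c k) :
    multinom4Sum b m ≤ multinom4Sum c m := by
  unfold multinom4Sum
  apply Finset.sum_le_sum
  intro x hx
  simp only [Finset.mem_filter, Finset.mem_product, Finset.mem_range] at hx
  obtain ⟨⟨h1, h2, h3, h4⟩, -⟩ := hx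
  have := hb _ h1
  have := hb _ h2
  have := hb _ h3
  have := hb _ h4
  have := hbc _ h1
  have := hbc _ h2
  have := hbc _ h3
  have := hbc _ h4
  have : 0 ≤ c x.1 := by linarith
  have : 0 ≤ c x.2.1 := by linarith
  have : 0 ≤ c x.2.2.1 := by linarith
  gcongr

lemma multinom6_mono {b c : ℕ → ℝ} {m : ℕ} (hb : ∀ k < m, 0 ≤ b k) (hbc : ∀ k < m, b k ≤ c k) :
    multinom6Sum b m ≤ multinom6Sum c m := by
  unfold multinom6Sum
  apply Finset.sum_le_sum
  intro x hx
  simp only [Finset.mem_filter, Finset.mem_product, Finset.mem_range] at hx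
  obtain ⟨⟨h1, h2, h3, h4, h5, h6⟩, -⟩ := hx
  have := hb _ h1
  have := hb _ h2
  have := hb _ h3
  have := hb _ h4
  have := hb _ h5
  have := hb _ h6
  have := hbc _ h1
  have := hbc _ h2
  have := hbc _ h3
  have := hbc _ h4
  have := hbc _ h5
  have := hbc _ h6
  have : 0 ≤ c x.1 := by linarith
  have : 0 ≤ c x.2.1 := by linarith
  have : 0 ≤ c x.2.2.1 := by linarith
  have : 0 ≤ c x.2.2.2.1 := by linarith
  have : 0 ≤ c x.2.2.2.2.1 := by linarith
  gcongr

lemma major_bound (N : ℝ) (hN : 0 < N) (b a : ℕ → ℝ) (hb0 : ∀ k, 0 ≤ b k)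
    (hbound : ∀ m : ℕ, 1 ≤ m → b m ≤ N * (multinom3Sum b m
          + (m : ℝ) * multinom4Sum b m + 1 / ((m : ℝ) + 1) * multinom6Sum b m))
    (ha0 : a 0 = b 0)
    (ha : ∀ m : ℕ, 1 ≤ m → a m =
      N * multinom3Sum a m + N * (m : ℝ) * multinom4Sum a m
        + N / ((m : ℝ) + 1) * multinom6Sum a m) : ∀ m, b m ≤ a m := by
  intro m
  induction m using Nat.strong_induction_on with
  | _ m ih =>
    rcases Nat.eq_zero_or_pos m with h | h
    · subst h; rw [ha0]
    · rw [ha m h]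
      refine (hbound m h).trans ?_
      have h3 := multinom3_mono (m := m) (fun k _ => hb0 k) ih
      have h4 := multinom4_mono (m := m) (fun k _ => hb0 k) ih
      have h6 := multinom6_mono (m := m) (fun k _ => hb0 k) ih
      have e : N * multinom3Sum a m + N * (m : ℝ) * multinom4Sum a m
        + N / ((m : ℝ) + 1) * multinom6Sum a m = N * (multinom3Sum a m
          + (m : ℝ) * multinom4Sum a m + 1 / ((m : ℝ) + 1) * multinom6Sum a m) := by ring
      rw [e]
      gcongr

def wt (a : ℕ → ℝ) (s : ℝ) (i : ℕ) : ℝ := a i / (i.factorial : ℝ) * s ^ (2 * i - 3)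

lemma wt_nonneg {a : ℕ → ℝ} (ha : ∀ k, 0 ≤ a k) {s : ℝ} (hs : 0 < s) (i : ℕ) : 0 ≤ wt a s i := by
  unfold wt
  have := ha i
  positivity

lemma m3_wt {a : ℕ → ℝ} (ha : ∀ k, 0 ≤ a k) {s : ℝ} (hs : 0 < s) (hs1 : s ≤ 1) {m : ℕ}
    (hm : 2 ≤ m) : multinom3Sum a m / (m.factorial : ℝ) * s ^ (2 * m - 3) ≤
      s * ∑ p ∈ (Finset.range m ×ˢ Finset.range m ×ˢ Finset.range m).filter
      (fun p => p.1 + p.2.1 + p.2.2 = m), wt a s p.1 * (wt a s p.2.1 * wt a s p.2.2) := by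
  unfold multinom3Sum
  rw [Finset.sum_div, Finset.sum_mul, Finset.mul_sum]
  apply Finset.sum_le_sum
  rintro ⟨i, j, k⟩ hx
  simp only [Finset.mem_filter, Finset.mem_product, Finset.mem_range] at hx ⊢
  obtain ⟨⟨h1, h2, h3⟩, h⟩ := hx
  have hf : (m.factorial : ℝ) ≠ 0 := by positivity
  have hi := ha i
  have hj := ha j
  have hk := ha k
  have e1 : s ^ (2 * m - 3) ≤ s ^ (1 + ((2 * i - 3) + ((2 * j - 3) + (2 * k - 3)))) :=
    pow_le_pow_of_le_one hs.le hs1 (by omega)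
  calc _ = (a i / (i.factorial : ℝ)) * (a j / (j.factorial : ℝ)) * (a k / (k.factorial : ℝ))
            * s ^ (2 * m - 3) := by field_simp
    _ ≤ (a i / (i.factorial : ℝ)) * (a j / (j.factorial : ℝ)) * (a k / (k.factorial : ℝ))
            * s ^ (1 + ((2 * i - 3) + ((2 * j - 3) + (2 * k - 3)))) := by gcongr
    _ = _ := by unfold wt; rw [pow_add, pow_add, pow_add, pow_one]; ring

lemma m4_wt {a : ℕ → ℝ} (ha : ∀ k, 0 ≤ a k) {s : ℝ} (hs : 0 < s) (hs1 : s ≤ 1) {m : ℕ}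
    (hm : 2 ≤ m) : (m : ℝ) * multinom4Sum a m / (m.factorial : ℝ) * s ^ (2 * m - 3) ≤
      s * ∑ q ∈ (Finset.range m ×ˢ Finset.range m ×ˢ Finset.range m ×ˢ Finset.range m).filter
      (fun q => q.1 + q.2.1 + q.2.2.1 + q.2.2.2 = m - 1),
        wt a s q.1 * (wt a s q.2.1 * (wt a s q.2.2.1 * wt a s q.2.2.2)) := by
  unfold multinom4Sum
  rw [Finset.mul_sum, Finset.sum_div, Finset.sum_mul, Finset.mul_sum]
  apply Finset.sum_le_sum
  rintro ⟨i, j, k, l⟩ hx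
  simp only [Finset.mem_filter, Finset.mem_product, Finset.mem_range] at hx ⊢
  obtain ⟨⟨h1, h2, h3, h4⟩, h⟩ := hx
  have hf : ((m - 1).factorial : ℝ) ≠ 0 := by positivity
  have hm0 : (m : ℝ) ≠ 0 := by positivity
  have hi := ha i
  have hj := ha j
  have hk := ha k
  have hl := ha l
  have e1 : s ^ (2 * m - 3) ≤ s ^ (1 + ((2 * i - 3) + ((2 * j - 3) + ((2 * k - 3) +
      (2 * l - 3))))) :=
    pow_le_pow_of_le_one hs.le hs1 (by omega)
  have e2 : (m.factorial : ℝ) = m * ((m - 1).factorial : ℝ) := by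
    rw [← Nat.mul_factorial_pred (by omega : m ≠ 0)]; push_cast; ring
  calc _ = (a i / (i.factorial : ℝ)) * (a j / (j.factorial : ℝ)) * (a k / (k.factorial : ℝ))
            * (a l / (l.factorial : ℝ)) * s ^ (2 * m - 3) := by rw [e2]; field_simp
    _ ≤ (a i / (i.factorial : ℝ)) * (a j / (j.factorial : ℝ)) * (a k / (k.factorial : ℝ))
            * (a l / (l.factorial : ℝ))
            * s ^ (1 + ((2 * i - 3) + ((2 * j - 3) + ((2 * k - 3) + (2 * l - 3))))) := by gcongr
    _ = _ := by unfold wt; rw [pow_add, pow_add, pow_add, pow_add, pow_one]; ring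

lemma m6_wt {a : ℕ → ℝ} (ha : ∀ k, 0 ≤ a k) {s : ℝ} (hs : 0 < s) (hs1 : s ≤ 1) {m : ℕ}
    (hm : 2 ≤ m) :
      1 / ((m : ℝ) + 1) * multinom6Sum a m / (m.factorial : ℝ) * s ^ (2 * m - 3) ≤
      s * ∑ r ∈ (Finset.range m ×ˢ Finset.range m ×ˢ Finset.range m ×ˢ Finset.range m ×ˢ
      Finset.range m ×ˢ Finset.range m).filter
      (fun r => r.1 + r.2.1 + r.2.2.1 + r.2.2.2.1 + r.2.2.2.2.1 + r.2.2.2.2.2 = m + 1),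
        wt a s r.1 * (wt a s r.2.1 * (wt a s r.2.2.1 * (wt a s r.2.2.2.1 *
          (wt a s r.2.2.2.2.1 * wt a s r.2.2.2.2.2)))) := by
  unfold multinom6Sum
  rw [Finset.mul_sum, Finset.sum_div, Finset.sum_mul, Finset.mul_sum]
  apply Finset.sum_le_sum
  rintro ⟨i, j, k, l, u, v⟩ hx
  simp only [Finset.mem_filter, Finset.mem_product, Finset.mem_range] at hx ⊢
  obtain ⟨⟨h1, h2, h3, h4, h5, h6⟩, h⟩ := hx
  have hf : (m.factorial : ℝ) ≠ 0 := by positivity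
  have hm0 : (m : ℝ) + 1 ≠ 0 := by positivity
  have hi := ha i
  have hj := ha j
  have hk := ha k
  have hl := ha l
  have hu := ha u
  have hv := ha v
  have e1 : s ^ (2 * m - 3) ≤ s ^ (1 + ((2 * i - 3) + ((2 * j - 3) + ((2 * k - 3) +
      ((2 * l - 3) + ((2 * u - 3) + (2 * v - 3))))))) :=
    pow_le_pow_of_le_one hs.le hs1 (by omega)
  have e2 : ((m + 1).factorial : ℝ) = (m + 1) * (m.factorial : ℝ) := by
    rw [Nat.factorial_succ]; push_cast; ring
  calc _ = (a i / (i.factorial : ℝ)) * (a j / (j.factorial : ℝ)) * (a k / (k.factorial : ℝ))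
            * (a l / (l.factorial : ℝ)) * (a u / (u.factorial : ℝ)) * (a v / (v.factorial : ℝ))
            * s ^ (2 * m - 3) := by rw [e2]; field_simp
    _ ≤ (a i / (i.factorial : ℝ)) * (a j / (j.factorial : ℝ)) * (a k / (k.factorial : ℝ))
            * (a l / (l.factorial : ℝ)) * (a u / (u.factorial : ℝ)) * (a v / (v.factorial : ℝ))
            * s ^ (1 + ((2 * i - 3) + ((2 * j - 3) + ((2 * k - 3) +
      ((2 * l - 3) + ((2 * u - 3) + (2 * v - 3))))))) := by gcongr
    _ = _ := by
      unfold wt; rw [pow_add, pow_add, pow_add, pow_add, pow_add, pow_add, pow_one]; ring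

lemma wt_step {N : ℝ} (hN : 0 < N) {a : ℕ → ℝ} (ha : ∀ k, 0 ≤ a k)
    (har : ∀ m : ℕ, 1 ≤ m → a m =
      N * multinom3Sum a m + N * (m : ℝ) * multinom4Sum a m
        + N / ((m : ℝ) + 1) * multinom6Sum a m)
    {s : ℝ} (hs : 0 < s) (hs1 : s ≤ 1) (n : ℕ) :
    ∑ m ∈ Finset.Icc 2 n, wt a s m ≤ N * s * ((∑ i ∈ Finset.range n, wt a s i) ^ 3
      + (∑ i ∈ Finset.range n, wt a s i) ^ 4 + (∑ i ∈ Finset.range n, wt a s i) ^ 6) := by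
  have hw := wt_nonneg ha hs
  set W := ∑ i ∈ Finset.range n, wt a s i with hW
  have c3 := aux_cover (Finset.range n ×ˢ Finset.range n ×ˢ Finset.range n) (Finset.Icc 2 n)
    (fun m => (Finset.range m ×ˢ Finset.range m ×ˢ Finset.range m).filter
      (fun p => p.1 + p.2.1 + p.2.2 = m)) (fun p => p.1 + p.2.1 + p.2.2)
    (fun p => wt a s p.1 * (wt a s p.2.1 * wt a s p.2.2))
    (fun x _ => mul_nonneg (hw _) (mul_nonneg (hw _) (hw _)))
    (by
      intro m hm x hx
      simp only [Finset.mem_filter, Finset.mem_product, Finset.mem_range, Finset.mem_Icc] at *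
      omega)
    (by
      intro m hm x hx
      simp only [Finset.mem_filter] at hx
      exact hx.2)
  have c4 := aux_cover (Finset.range n ×ˢ Finset.range n ×ˢ Finset.range n ×ˢ Finset.range n)
    (Finset.Icc 2 n)
    (fun m => (Finset.range m ×ˢ Finset.range m ×ˢ Finset.range m ×ˢ Finset.range m).filter
      (fun q => q.1 + q.2.1 + q.2.2.1 + q.2.2.2 = m - 1))
    (fun q => q.1 + q.2.1 + q.2.2.1 + q.2.2.2 + 1)
    (fun q => wt a s q.1 * (wt a s q.2.1 * (wt a s q.2.2.1 * wt a s q.2.2.2)))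
    (fun x _ => mul_nonneg (hw _) (mul_nonneg (hw _) (mul_nonneg (hw _) (hw _))))
    (by
      intro m hm x hx
      simp only [Finset.mem_filter, Finset.mem_product, Finset.mem_range, Finset.mem_Icc] at *
      omega)
    (by
      intro m hm x hx
      simp only [Finset.mem_filter, Finset.mem_Icc] at hx hm
      have := hx.2
      omega)
  have c6 := aux_cover (Finset.range n ×ˢ Finset.range n ×ˢ Finset.range n ×ˢ Finset.range n
      ×ˢ Finset.range n ×ˢ Finset.range n)
    (Finset.Icc 2 n)
    (fun m => (Finset.range m ×ˢ Finset.range m ×ˢ Finset.range m ×ˢ Finset.range m ×ˢ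
      Finset.range m ×ˢ Finset.range m).filter
      (fun r => r.1 + r.2.1 + r.2.2.1 + r.2.2.2.1 + r.2.2.2.2.1 + r.2.2.2.2.2 = m + 1))
    (fun r => r.1 + r.2.1 + r.2.2.1 + r.2.2.2.1 + r.2.2.2.2.1 + r.2.2.2.2.2 - 1)
    (fun r => wt a s r.1 * (wt a s r.2.1 * (wt a s r.2.2.1 * (wt a s r.2.2.2.1 *
          (wt a s r.2.2.2.2.1 * wt a s r.2.2.2.2.2)))))
    (fun x _ => mul_nonneg (hw _) (mul_nonneg (hw _) (mul_nonneg (hw _) (mul_nonneg (hw _)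
      (mul_nonneg (hw _) (hw _))))))
    (by
      intro m hm x hx
      simp only [Finset.mem_filter, Finset.mem_product, Finset.mem_range, Finset.mem_Icc] at *
      omega)
    (by
      intro m hm x hx
      simp only [Finset.mem_filter, Finset.mem_Icc] at hx hm
      have := hx.2
      omega)
  simp only [Finset.sum_product, ← Finset.mul_sum, ← Finset.sum_mul] at c3 c4 c6
  have key : ∀ m ∈ Finset.Icc 2 n, wt a s m ≤ N * (s * (∑ p ∈ (Finset.range m ×ˢ Finset.range m ×ˢ Finset.range m).filter
      (fun p => p.1 + p.2.1 + p.2.2 = m), wt a s p.1 * (wt a s p.2.1 * wt a s p.2.2))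
      + s * (∑ q ∈ (Finset.range m ×ˢ Finset.range m ×ˢ Finset.range m ×ˢ Finset.range m).filter
      (fun q => q.1 + q.2.1 + q.2.2.1 + q.2.2.2 = m - 1),
        wt a s q.1 * (wt a s q.2.1 * (wt a s q.2.2.1 * wt a s q.2.2.2)))
      + s * (∑ r ∈ (Finset.range m ×ˢ Finset.range m ×ˢ Finset.range m ×ˢ Finset.range m ×ˢ
      Finset.range m ×ˢ Finset.range m).filter
      (fun r => r.1 + r.2.1 + r.2.2.1 + r.2.2.2.1 + r.2.2.2.2.1 + r.2.2.2.2.2 = m + 1),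
        wt a s r.1 * (wt a s r.2.1 * (wt a s r.2.2.1 * (wt a s r.2.2.2.1 *
          (wt a s r.2.2.2.2.1 * wt a s r.2.2.2.2.2)))))) := by
    intro m hm
    have hm2 : 2 ≤ m := (Finset.mem_Icc.mp hm).1
    have e : wt a s m = N * (multinom3Sum a m / (m.factorial : ℝ) * s ^ (2 * m - 3)
       + (m : ℝ) * multinom4Sum a m / (m.factorial : ℝ) * s ^ (2 * m - 3)
       + 1 / ((m : ℝ) + 1) * multinom6Sum a m / (m.factorial : ℝ) * s ^ (2 * m - 3)) := by
      rw [wt, har m (by omega)]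
      ring
    rw [e]
    have := m3_wt ha hs hs1 hm2
    have := m4_wt ha hs hs1 hm2
    have := m6_wt ha hs hs1 hm2
    gcongr
  refine (Finset.sum_le_sum key).trans ?_
  rw [← Finset.mul_sum, Finset.sum_add_distrib, Finset.sum_add_distrib, ← Finset.mul_sum,
    ← Finset.mul_sum, ← Finset.mul_sum, ← mul_add, ← mul_add, ← mul_assoc]
  have d3 : W * (W * W) = W ^ 3 := by ring
  have d4 : W * (W * (W * W)) = W ^ 4 := by ring
  have d6 : W * (W * (W * (W * (W * W)))) = W ^ 6 := by ring
  rw [← hW] at c3 c4 c6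
  rw [d3] at c3
  rw [d4] at c4
  rw [d6] at c6
  gcongr

lemma major_growth {N : ℝ} (hN : 0 < N) {a : ℕ → ℝ} (ha : ∀ k, 0 ≤ a k)
    (har : ∀ m : ℕ, 1 ≤ m → a m =
      N * multinom3Sum a m + N * (m : ℝ) * multinom4Sum a m
        + N / ((m : ℝ) + 1) * multinom6Sum a m) :
    ∃ B R : ℝ, 1 ≤ B ∧ 1 ≤ R ∧ ∀ m, a m ≤ (m.factorial : ℝ) * (B * R ^ m) := by
  set B := a 0 + a 1 + 1 with hB
  have h0 := ha 0
  have h1 := ha 1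
  have hB1 : 1 ≤ B := by linarith
  set Q := N * (B ^ 3 + B ^ 4 + B ^ 6) with hQ
  have hQ0 : 0 < Q := by positivity
  set s := 1 / (1 + Q) with hsdef
  have hs : 0 < s := by positivity
  have hs1 : s ≤ 1 := by
    rw [hsdef, div_le_one (by positivity)]; linarith
  have hsQ : s * Q ≤ 1 := by
    rw [hsdef, one_div, inv_mul_le_iff₀ (by positivity)]; linarith
  have hw := wt_nonneg ha hs
  have hW : ∀ n, ∑ i ∈ Finset.range n, wt a s i ≤ B := by
    intro n
    induction n with
    | zero => simp; linarith
    | succ n ih =>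
      have hsub : Finset.range (n + 1) ⊆ {0, 1} ∪ Finset.Icc 2 n := by
        intro i hi
        simp only [Finset.mem_range, Finset.mem_union, Finset.mem_insert, Finset.mem_singleton,
          Finset.mem_Icc] at *
        omega
      have hdis : Disjoint ({0, 1} : Finset ℕ) (Finset.Icc 2 n) := by
        rw [Finset.disjoint_left]
        intro i hi
        simp only [Finset.mem_insert, Finset.mem_singleton, Finset.mem_Icc] at *
        omega
      have l1 : ∑ i ∈ Finset.range (n + 1), wt a s i ≤
          ∑ i ∈ ({0, 1} : Finset ℕ), wt a s i + ∑ i ∈ Finset.Icc 2 n, wt a s i := by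
        rw [← Finset.sum_union hdis]
        exact Finset.sum_le_sum_of_subset_of_nonneg hsub (fun i _ _ => hw i)
      have l2 := wt_step hN ha har hs hs1 n
      have hp : 0 ≤ ∑ i ∈ Finset.range n, wt a s i := Finset.sum_nonneg (fun i _ => hw i)
      have l3 : N * s * ((∑ i ∈ Finset.range n, wt a s i) ^ 3
        + (∑ i ∈ Finset.range n, wt a s i) ^ 4 + (∑ i ∈ Finset.range n, wt a s i) ^ 6) ≤
          N * s * (B ^ 3 + B ^ 4 + B ^ 6) := by gcongr
      have l4 : ∑ i ∈ ({0, 1} : Finset ℕ), wt a s i = a 0 + a 1 := by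
        rw [Finset.sum_pair (by norm_num)]
        simp [wt]
      have l5 : N * s * (B ^ 3 + B ^ 4 + B ^ 6) = s * Q := by rw [hQ]; ring
      linarith
  refine ⟨B, (1 / s) ^ 2, hB1, ?_, ?_⟩
  · apply one_le_pow₀
    rw [le_div_iff₀ hs]; linarith
  · intro m
    have hm : wt a s m ≤ B :=
      (Finset.single_le_sum (fun i _ => hw i) (Finset.self_mem_range_succ m)).trans (hW (m + 1))
    have e1 : s ^ (2 * m) ≤ s ^ (2 * m - 3) := pow_le_pow_of_le_one hs.le hs1 (by omega)
    have ham := ha m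
    have e2 : a m / (m.factorial : ℝ) * s ^ (2 * m) ≤ B := by
      refine le_trans ?_ hm
      unfold wt
      gcongr
    have e3 : a m = (m.factorial : ℝ) * (a m / (m.factorial : ℝ) * s ^ (2 * m)
        * ((1 / s) ^ 2) ^ m) := by
      rw [← pow_mul, one_div, inv_pow]
      have : s ^ (2 * m) ≠ 0 := by positivity
      field_simp
    rw [e3]
    gcongr

def bconv (u v : ℕ → ℝ) (n : ℕ) : ℝ :=
  ∑ i ∈ Finset.range (n + 1), (n.choose i : ℝ) * u i * v (n - i)

def egf (u : ℕ → ℝ) (t : ℝ) : ℝ := ∑' n : ℕ, u n * t ^ n / (n.factorial : ℝ)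

def GB (B R : ℝ) (u : ℕ → ℝ) : Prop := ∀ n, |u n| ≤ (n.factorial : ℝ) * (B * R ^ n)

lemma GB.norm_le {B R : ℝ} {u : ℕ → ℝ} (h : GB B R u) (t : ℝ) (n : ℕ) :
    ‖u n * t ^ n / (n.factorial : ℝ)‖ ≤ B * (|t| * R) ^ n := by
  rw [Real.norm_eq_abs, abs_div, abs_mul, abs_pow, Nat.abs_cast,
    div_le_iff₀ (by positivity : (0 : ℝ) < (n.factorial : ℝ))]
  calc |u n| * |t| ^ n ≤ ((n.factorial : ℝ) * (B * R ^ n)) * |t| ^ n := by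
        gcongr
        exact h n
    _ = _ := by rw [mul_pow]; ring

lemma GB.summable {B R : ℝ} {u : ℕ → ℝ} (h : GB B R u) (hR : 1 ≤ R) {t : ℝ} (ht : |t| * R < 1) :
    Summable (fun n : ℕ => ‖u n * t ^ n / (n.factorial : ℝ)‖) :=
  Summable.of_nonneg_of_le (fun _ => norm_nonneg _) (h.norm_le t)
    ((summable_geometric_of_lt_one (by positivity) ht).mul_left B)

lemma GB.mono {B B' R R' : ℝ} {u : ℕ → ℝ} (h : GB B R u) (hB : 0 ≤ B) (hR : 0 ≤ R) (hBB : B ≤ B')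
    (hRR : R ≤ R') : GB B' R' u := by
  intro n
  refine (h n).trans ?_
  have : 0 ≤ B' := hB.trans hBB
  gcongr

lemma GB.add {B B' R : ℝ} {u v : ℕ → ℝ} (h : GB B R u) (h' : GB B' R v) :
    GB (B + B') R (fun n => u n + v n) := by
  intro n
  calc |u n + v n| ≤ |u n| + |v n| := abs_add_le _ _
    _ ≤ _ := add_le_add (h n) (h' n)
    _ = _ := by ring

lemma GB.smul {B R : ℝ} {u : ℕ → ℝ} (h : GB B R u) (c : ℝ) :
    GB (|c| * B) R (fun n => c * u n) := by
  intro n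
  rw [abs_mul]
  calc |c| * |u n| ≤ |c| * ((n.factorial : ℝ) * (B * R ^ n)) := by
        gcongr
        exact h n
    _ = _ := by ring

lemma bconv_div (u v : ℕ → ℝ) (t : ℝ) (n : ℕ) :
    bconv u v n * t ^ n / (n.factorial : ℝ) = ∑ k ∈ Finset.range (n + 1),
      (u k * t ^ k / (k.factorial : ℝ)) * (v (n - k) * t ^ (n - k) / ((n - k).factorial : ℝ)) := by
  unfold bconv
  rw [Finset.sum_mul, Finset.sum_div]
  apply Finset.sum_congr rfl
  intro k hk
  have hk' : k ≤ n := Nat.lt_succ_iff.mp (Finset.mem_range.mp hk)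
  have e : (n.choose k : ℝ) = (n.factorial : ℝ) / ((k.factorial : ℝ) * ((n - k).factorial : ℝ)) :=
    Nat.cast_choose ℝ hk'
  have e2 : t ^ n = t ^ k * t ^ (n - k) := by rw [← pow_add]; congr 1; omega
  rw [e, e2]
  have : (n.factorial : ℝ) ≠ 0 := by positivity
  field_simp

lemma GB.bconv {B B' R : ℝ} {u v : ℕ → ℝ} (h : GB B R u) (h' : GB B' R v) (hB : 0 ≤ B)
    (hB' : 0 ≤ B') (hR : 0 ≤ R) : GB (B * B') (2 * R) (bconv u v) := by
  intro n
  have e := bconv_div u v 1 n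
  simp only [one_pow, mul_one] at e
  have hf : (0 : ℝ) < (n.factorial : ℝ) := by positivity
  have e' : _root_.bconv u v n = (n.factorial : ℝ) * ∑ k ∈ Finset.range (n + 1),
      (u k / (k.factorial : ℝ)) * (v (n - k) / ((n - k).factorial : ℝ)) := by
    rw [← e]; field_simp
  rw [e', abs_mul, Nat.abs_cast]
  gcongr
  have hb : ∀ k ∈ Finset.range (n + 1), |(u k / (k.factorial : ℝ)) *
      (v (n - k) / ((n - k).factorial : ℝ))| ≤ B * B' * R ^ n := by
    intro k hk
    have hk' : k ≤ n := Nat.lt_succ_iff.mp (Finset.mem_range.mp hk)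
    have h1 := h.norm_le 1 k
    have h2 := h'.norm_le 1 (n - k)
    simp only [one_pow, mul_one, abs_one, one_mul, Real.norm_eq_abs] at h1 h2
    rw [abs_mul]
    calc _ ≤ (B * R ^ k) * (B' * R ^ (n - k)) := by gcongr
      _ = B * B' * (R ^ k * R ^ (n - k)) := by ring
      _ = _ := by rw [← pow_add]; congr 2; omega
  refine (Finset.abs_sum_le_sum_abs _ _).trans ((Finset.sum_le_sum hb).trans ?_)
  rw [Finset.sum_const, Finset.card_range, nsmul_eq_mul, mul_pow]
  have h2 : ((n + 1 : ℕ) : ℝ) ≤ 2 ^ n := by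
    have : n + 1 ≤ 2 ^ n := Nat.lt_two_pow_self
    exact_mod_cast this
  calc _ ≤ (2 : ℝ) ^ n * (B * B' * R ^ n) := by gcongr
    _ = _ := by ring

lemma egf_bconv {B B' R : ℝ} {u v : ℕ → ℝ} (h : GB B R u) (h' : GB B' R v) (hR : 1 ≤ R) {t : ℝ}
    (ht : |t| * R < 1) : egf (bconv u v) t = egf u t * egf v t := by
  unfold egf
  rw [tsum_mul_tsum_eq_tsum_sum_range_of_summable_norm (h.summable hR ht) (h'.summable hR ht)]
  exact tsum_congr (bconv_div u v t)

lemma egf_add {B B' R : ℝ} {u v : ℕ → ℝ} (h : GB B R u) (h' : GB B' R v) (hR : 1 ≤ R) {t : ℝ}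
    (ht : |t| * R < 1) : egf (fun n => u n + v n) t = egf u t + egf v t := by
  unfold egf
  rw [← (h.summable hR ht).of_norm.tsum_add (h'.summable hR ht).of_norm]
  exact tsum_congr (fun n => by ring)

lemma egf_smul (c : ℝ) (u : ℕ → ℝ) (t : ℝ) : egf (fun n => c * u n) t = c * egf u t := by
  unfold egf
  rw [← tsum_mul_left]
  exact tsum_congr (fun n => by ring)

def dlt (n : ℕ) : ℝ := if n = 0 then 1 else 0

lemma GB_dlt {R : ℝ} (hR : 1 ≤ R) : GB 1 R dlt := by
  intro n
  unfold dlt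
  split_ifs with h
  · subst h; simp
  · have : 0 ≤ R := by linarith
    simp; positivity

lemma egf_dlt (t : ℝ) : egf dlt t = 1 := by
  unfold egf
  rw [tsum_eq_single 0]
  · simp [dlt]
  · intro n hn
    simp [dlt, hn]

/-- twice the mean curvature sequence -/
def HH (X Y A E D : ℕ → ℝ) : ℕ → ℝ := fun n =>
  bconv (fun k => dlt k + bconv Y Y k) A n + ((-2) * bconv (bconv X Y) E n
    + bconv (fun k => dlt k + bconv X X k) D n)

def GG (X Y : ℕ → ℝ) : ℕ → ℝ := fun k => dlt k + (bconv X X k + bconv Y Y k)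

def DD (A E D : ℕ → ℝ) : ℕ → ℝ := fun k => bconv E E k + (-1) * bconv A D k

lemma egf_HH {B R : ℝ} {X Y A E D : ℕ → ℝ} (hB : 1 ≤ B) (hR : 1 ≤ R) (hX : GB B R X)
    (hY : GB B R Y) (hA : GB B R A) (hE : GB B R E) (hD : GB B R D) :
    ∃ C, 0 ≤ C ∧ C = 2 * ((1 + B * B) * B) + 2 * (B * B * B) ∧ GB C (4 * R) (HH X Y A E D) ∧
    ∀ t, |t| * (4 * R) < 1 → egf (HH X Y A E D) t =
      (1 + egf Y t ^ 2) * egf A t - 2 * egf X t * egf Y t * egf E t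
        + (1 + egf X t ^ 2) * egf D t := by
  have hB0 : 0 ≤ B := by linarith
  have hR0 : 0 ≤ R := by linarith
  have hR2 : 1 ≤ 2 * R := by linarith
  have e4 : 2 * (2 * R) = 4 * R := by ring
  have up : ∀ {u}, GB B R u → GB B (2 * R) u := fun h => h.mono hB0 hR0 le_rfl (by linarith)
  have hYY := (GB_dlt hR2).add (hY.bconv hY hB0 hB0 hR0)
  have hXX := (GB_dlt hR2).add (hX.bconv hX hB0 hB0 hR0)
  have hXY := hX.bconv hY hB0 hB0 hR0
  have t1 := hYY.bconv (up hA) (by positivity) hB0 (by positivity)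
  have t2 := (hXY.bconv (up hE) (by positivity) hB0 (by positivity)).smul (-2)
  have t3 := hXX.bconv (up hD) (by positivity) hB0 (by positivity)
  rw [e4] at t1 t2 t3
  have t23 := t2.add t3
  refine ⟨_, by positivity, rfl, ?_, ?_⟩
  · have := t1.add t23
    intro n
    refine (this n).trans (le_of_eq ?_)
    rw [abs_neg, abs_two]; ring
  · intro t ht
    have ht0 := abs_nonneg t
    have ht2 : |t| * (2 * R) < 1 := by nlinarith
    have ht1 : |t| * R < 1 := by nlinarith
    have hR4 : 1 ≤ 4 * R := by linarith
    unfold HH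
    rw [egf_add t1 t23 hR4 ht, egf_add t2 t3 hR4 ht, egf_smul, egf_bconv hYY (up hA) hR2 ht2,
      egf_bconv hXY (up hE) hR2 ht2, egf_bconv hXX (up hD) hR2 ht2,
      egf_add (GB_dlt hR2) (hY.bconv hY hB0 hB0 hR0) hR2 ht2,
      egf_add (GB_dlt hR2) (hX.bconv hX hB0 hB0 hR0) hR2 ht2, egf_bconv hY hY hR ht1,
      egf_bconv hX hX hR ht1, egf_bconv hX hY hR ht1, egf_dlt]
    ring

lemma egf_KK {B R : ℝ} {X Y A E D : ℕ → ℝ} (hB : 1 ≤ B) (hR : 1 ≤ R) (hX : GB B R X)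
    (hY : GB B R Y) (hA : GB B R A) (hE : GB B R E) (hD : GB B R D) (t : ℝ)
    (ht : |t| * (4 * R) < 1) : egf (bconv (GG X Y) (DD A E D)) t =
      (1 + egf X t ^ 2 + egf Y t ^ 2) * (egf E t ^ 2 - egf A t * egf D t) := by
  have hB0 : 0 ≤ B := by linarith
  have hR0 : 0 ≤ R := by linarith
  have hR2 : 1 ≤ 2 * R := by linarith
  have ht0 := abs_nonneg t
  have ht2 : |t| * (2 * R) < 1 := by nlinarith
  have ht1 : |t| * R < 1 := by nlinarith
  have a1 := hX.bconv hX hB0 hB0 hR0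
  have a2 := hY.bconv hY hB0 hB0 hR0
  have a3 := hE.bconv hE hB0 hB0 hR0
  have a4 := (hA.bconv hD hB0 hB0 hR0).smul (-1)
  have g : GB _ _ (GG X Y) := (GB_dlt hR2).add (a1.add a2)
  have d : GB _ _ (DD A E D) := a3.add a4
  rw [egf_bconv g d hR2 ht2]
  unfold GG DD
  rw [egf_add (GB_dlt hR2) (a1.add a2) hR2 ht2, egf_add a1 a2 hR2 ht2, egf_add a3 a4 hR2 ht2,
    egf_smul, egf_bconv hX hX hR ht1, egf_bconv hY hY hR ht1, egf_bconv hE hE hR ht1,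
    egf_bconv hA hD hR ht1, egf_dlt]
  ring

/-- If `u ⋆ u` is `t² k` then `u = t √k` for small `t`. -/
lemma egf_sqrt {C ρ δ : ℝ} {u k : ℕ → ℝ} (hC : 0 ≤ C) (hρ : 1 ≤ ρ) (hδ : 0 < δ) (hu : GB C ρ u)
    (hu0 : u 0 = 0) (hu1 : δ ≤ u 1)
    (hconv : ∀ n, bconv u u (n + 2) = (n + 2) * (n + 1) * k n) {t : ℝ}
    (ht : |t| * ρ ≤ 1 / 2) (ht2 : 2 * C * ρ ^ 2 * |t| ≤ δ) :
    egf u t = t * Real.sqrt (egf k t) := by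
  have hρ0 : 0 ≤ ρ := by linarith
  have ht1 : |t| * ρ < 1 := by linarith
  have hs := (hu.summable hρ ht1).of_norm
  -- square
  have sq : egf u t ^ 2 = t ^ 2 * egf k t := by
    have h1 := egf_bconv hu hu hρ ht1
    have h2 : Summable (fun n : ℕ => bconv u u n * t ^ n / (n.factorial : ℝ)) := by
      have := summable_norm_sum_mul_range_of_summable_norm (hu.summable hρ ht1)
        (hu.summable hρ ht1)
      have := this.of_norm
      refine this.congr (fun n => ?_)
      exact (bconv_div u u t n).symm
    have h3 := h2.sum_add_tsum_nat_add 2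
    have b0 : bconv u u 0 = 0 := by simp [bconv, hu0]
    have b1 : bconv u u 1 = 0 := by simp [bconv, Finset.sum_range_succ, hu0]
    rw [Finset.sum_range_succ, Finset.sum_range_one, b0, b1] at h3
    rw [sq, ← h1]
    unfold egf
    rw [← h3, ← tsum_mul_left]
    simp only [zero_mul, zero_div, zero_add]
    apply tsum_congr
    intro n
    rw [hconv n, Nat.factorial_succ, Nat.factorial_succ]
    push_cast
    have : (n.factorial : ℝ) ≠ 0 := by positivity
    have : (n : ℝ) + 1 ≠ 0 := by positivity
    have : (n : ℝ) + 1 + 1 ≠ 0 := by positivity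
    field_simp
    ring
  have rem : |egf u t - u 1 * t| ≤ 2 * C * ρ ^ 2 * t ^ 2 := by
    have h3 := hs.sum_add_tsum_nat_add 2
    rw [Finset.sum_range_succ, Finset.sum_range_one, hu0] at h3
    have h4 : egf u t - u 1 * t =
        ∑' n : ℕ, u (n + 2) * t ^ (n + 2) / ((n + 2).factorial : ℝ) := by
      unfold egf; rw [← h3]; simp
    rw [h4, ← Real.norm_eq_abs]
    have hg := (hasSum_geometric_of_lt_one (by positivity) ht1).mul_left (C * (|t| * ρ) ^ 2)
    have h5 := tsum_of_norm_bounded (f := fun n : ℕ => u (n + 2) * t ^ (n + 2) / ((n + 2).factorial : ℝ)) hg (fun n => by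
      refine (hu.norm_le t (n + 2)).trans (le_of_eq ?_)
      rw [pow_add]; ring)
    refine h5.trans ?_
    have h6 : (1 - |t| * ρ)⁻¹ ≤ 2 := by
      rw [inv_le_comm₀ (by linarith) (by norm_num)]; linarith
    calc C * (|t| * ρ) ^ 2 * (1 - |t| * ρ)⁻¹ ≤ C * (|t| * ρ) ^ 2 * 2 := by gcongr
      _ = 2 * C * ρ ^ 2 * |t| ^ 2 := by ring
      _ = _ := by rw [sq_abs]
  rcases eq_or_ne t 0 with h | h
  · subst h
    rw [zero_mul]
    have : egf u 0 ^ 2 = 0 := by rw [sq]; ring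
    exact pow_eq_zero_iff (two_ne_zero) |>.mp this
  · have htp : 0 < |t| := abs_pos.mpr h
    have hpos : 0 ≤ egf u t / t := by
      have e1 : egf u t / t = u 1 + (egf u t - u 1 * t) / t := by field_simp; ring
      have e2 : |(egf u t - u 1 * t) / t| ≤ δ := by
        rw [abs_div, div_le_iff₀ htp]
        refine rem.trans ?_
        calc 2 * C * ρ ^ 2 * t ^ 2 = (2 * C * ρ ^ 2 * |t|) * |t| := by
              rw [← sq_abs t]; ring
          _ ≤ δ * |t| := by gcongr
      have := (abs_le.mp e2).1
      rw [e1]; linarith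
    have e3 : egf k t = (egf u t / t) ^ 2 := by
      rw [div_pow, sq]; field_simp
    rw [e3, Real.sqrt_sq hpos]
    field_simp

section alg
variable (f : ℕ → ℝ × ℝ → ℝ) (p : ℝ × ℝ)

lemma sum_split {m : ℕ} (hm : 1 ≤ m) (g : ℕ → ℝ) :
    ∑ r ∈ Finset.range (m + 1), g r = g 0 + ∑ r ∈ Finset.Icc 1 (m - 1), g r + g m := by
  obtain ⟨n, rfl⟩ : ∃ n, m = n + 1 := ⟨m - 1, by omega⟩
  rw [Finset.sum_range_succ, Finset.sum_range_succ', add_comm _ (g 0)]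
  congr 2
  have : Finset.Icc 1 (n + 1 - 1) = (Finset.range n).image (fun i => i + 1) := by
    ext i
    simp only [Finset.mem_Icc, Finset.mem_image, Finset.mem_range]
    constructor
    · intro h; exact ⟨i - 1, by omega, by omega⟩
    · rintro ⟨j, hj, rfl⟩; omega
  rw [this, Finset.sum_image (fun a _ b _ h => by simpa using h)]

lemma fy2r_eq (r : ℕ) : fy2r f r p = dlt r + bconv (fun n => pdy (f n) p) (fun n => pdy (f n) p) r :=
  rfl

lemma fx2r_eq (r : ℕ) : fx2r f r p = dlt r + bconv (fun n => pdx (f n) p) (fun n => pdx (f n) p) r :=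
  rfl

lemma fxfyr_eq (r : ℕ) : fxfyr f r p = bconv (fun n => pdx (f n) p) (fun n => pdy (f n) p) r :=
  rfl

lemma HH_eq (n : ℕ) : HH (fun n => pdx (f n) p) (fun n => pdy (f n) p) (fun n => fxx (f n) p)
    (fun n => fxy (f n) p) (fun n => fyy (f n) p) n = 2 * Hseq f n p := by
  simp only [HH, Hseq, ← fy2r_eq, ← fx2r_eq]
  rw [bconv, bconv, bconv, Finset.mul_sum, ← Finset.sum_add_distrib, ← Finset.sum_add_distrib,
    Finset.mul_sum, Finset.mul_sum]
  apply Finset.sum_congr rfl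
  intro r _
  rw [fxfyr_eq]
  ring

lemma KK_eq (n : ℕ) : bconv (GG (fun n => pdx (f n) p) (fun n => pdy (f n) p))
   (DD (fun n => fxx (f n) p) (fun n => fxy (f n) p) (fun n => fyy (f n) p)) n = - Kseq f n p := by
  have h1 : ∀ r, gradSqr f r p = GG (fun n => pdx (f n) p) (fun n => pdy (f n) p) r := by
    intro r
    rw [gradSqr, GG, bconv, bconv, ← Finset.sum_add_distrib, dlt]
    congr 1
    apply Finset.sum_congr rfl
    intro i _
    ring
  have h2 : ∀ r, hessDiscr f r p =
      DD (fun n => fxx (f n) p) (fun n => fxy (f n) p) (fun n => fyy (f n) p) r := by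
    intro r
    rw [hessDiscr, DD, bconv, bconv, Finset.mul_sum, ← Finset.sum_add_distrib]
    apply Finset.sum_congr rfl
    intro i _
    ring
  rw [Kseq, neg_neg, bconv]
  simp only [h1, h2]

lemma Hop_identity {m : ℕ} (hm : 1 ≤ m) : 2 * Hseq f m p = Hop f 0 (f m) p
    + ∑ r ∈ Finset.Icc 1 (m - 1), (m.choose r : ℝ) * Hop f r (f (m - r)) p := by
  have hm0 : m ≠ 0 := by omega
  have s1 : fy2r f m p = 2 * (pdy (f 0) p * pdy (f m) p) + ∑ r ∈ Finset.Icc 1 (m - 1),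
      (m.choose r : ℝ) * pdy (f r) p * pdy (f (m - r)) p := by
    rw [fy2r, sum_split hm]; simp [hm0]; ring
  have s2 : fx2r f m p = 2 * (pdx (f 0) p * pdx (f m) p) + ∑ r ∈ Finset.Icc 1 (m - 1),
      (m.choose r : ℝ) * pdx (f r) p * pdx (f (m - r)) p := by
    rw [fx2r, sum_split hm]; simp [hm0]; ring
  have s3 : fxfyr f m p = pdx (f 0) p * pdy (f m) p + pdx (f m) p * pdy (f 0) p +
      ∑ r ∈ Finset.Icc 1 (m - 1), (m.choose r : ℝ) * pdx (f r) p * pdy (f (m - r)) p := by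
    rw [fxfyr, sum_split hm]; simp; ring
  have s4 : ∑ r ∈ Finset.Icc 1 (m - 1), (m.choose r : ℝ) * pdx (f r) p * pdy (f (m - r)) p
     = ∑ r ∈ Finset.Icc 1 (m - 1), (m.choose r : ℝ) * pdy (f r) p * pdx (f (m - r)) p := by
    apply Finset.sum_nbij' (fun r => m - r) (fun r => m - r)
    · intro r hr; simp only [Finset.mem_Icc] at *; omega
    · intro r hr; simp only [Finset.mem_Icc] at *; omega
    · intro r hr; simp only [Finset.mem_Icc] at *; omega
    · intro r hr; simp only [Finset.mem_Icc] at *; omega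
    · intro r hr
      simp only [Finset.mem_Icc] at hr
      rw [Nat.choose_symm (by omega), show m - (m - r) = r by omega]
      ring
  have s5 : ∑ r ∈ Finset.Icc 1 (m - 1), (m.choose r : ℝ) * Hop f r (f (m - r)) p =
      ∑ r ∈ Finset.Icc 1 (m - 1), (m.choose r : ℝ) *
    (fy2r f r p * fxx (f (m - r)) p - 2 * fxfyr f r p * fxy (f (m - r)) p
      + fx2r f r p * fyy (f (m - r)) p)
      + (fyy (f 0) p * (∑ r ∈ Finset.Icc 1 (m - 1), (m.choose r : ℝ) * pdx (f r) p * pdx (f (m - r)) p)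
      - fxy (f 0) p * (∑ r ∈ Finset.Icc 1 (m - 1), (m.choose r : ℝ) * pdy (f r) p * pdx (f (m - r)) p)
      + fxx (f 0) p * (∑ r ∈ Finset.Icc 1 (m - 1), (m.choose r : ℝ) * pdy (f r) p * pdy (f (m - r)) p)
      - fxy (f 0) p * (∑ r ∈ Finset.Icc 1 (m - 1), (m.choose r : ℝ) * pdx (f r) p * pdy (f (m - r)) p)) := by
    rw [Finset.mul_sum, Finset.mul_sum, Finset.mul_sum, Finset.mul_sum, ← Finset.sum_sub_distrib,
      ← Finset.sum_add_distrib, ← Finset.sum_sub_distrib, ← Finset.sum_add_distrib]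
    apply Finset.sum_congr rfl
    intro r hr
    simp only [Finset.mem_Icc] at hr
    rw [Hop, if_neg (by omega : ¬ r = 0)]
    ring
  rw [s5, Hseq, sum_split hm, Nat.sub_self, Nat.sub_zero, s1, s2, s3, Hop, ← s4]
  simp only [Nat.choose_zero_right, Nat.choose_self, Nat.cast_one, if_true]
  ring

lemma two_H_eq {m : ℕ} (hm : 1 ≤ m) (h : Hop f 0 (f m) p = ellipticRHS f m p) :
    2 * Hseq f m p = (-(m : ℝ) * Kseq f (m - 1) p
      - 4 / ((m : ℝ) + 1) * ∑ r ∈ Finset.Icc 2 (m - 1), ((m + 1).choose r : ℝ) *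
          Hseq f r p * Hseq f (m - r + 1) p)
    / ((2 : ℝ) ^ (1 - (if m = 1 then 1 else 0) : ℕ) * Real.sqrt (-Kseq f 0 p)) := by
  rw [Hop_identity f p hm, h, ellipticRHS]
  ring

lemma H_conv (hK : 0 < - Kseq f 0 p) (h0 : Hseq f 0 p = 0)
    (h : ∀ m, 1 ≤ m → Hop f 0 (f m) p = ellipticRHS f m p) :
    2 * Hseq f 1 p = Real.sqrt (-Kseq f 0 p) ∧
    ∀ n : ℕ, bconv (fun n => 2 * Hseq f n p) (fun n => 2 * Hseq f n p) (n + 2) =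
      ((n : ℝ) + 2) * ((n : ℝ) + 1) * (- Kseq f n p) := by
  have hs : 0 < Real.sqrt (-Kseq f 0 p) := Real.sqrt_pos.mpr hK
  have hss : Real.sqrt (-Kseq f 0 p) * Real.sqrt (-Kseq f 0 p) = -Kseq f 0 p :=
    Real.mul_self_sqrt hK.le
  have h1 : 2 * Hseq f 1 p = Real.sqrt (-Kseq f 0 p) := by
    have := two_H_eq f p le_rfl (h 1 le_rfl)
    rw [this]
    simp only [Nat.sub_self, Nat.cast_one, if_true, pow_zero, one_mul]
    rw [div_eq_iff hs.ne', hss]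
    simp
  refine ⟨h1, ?_⟩
  intro n
  rw [bconv, sum_split (by omega : 1 ≤ n + 2)]
  simp only [Nat.sub_self, Nat.sub_zero, h0, mul_zero, zero_mul, zero_add, add_zero]
  rcases Nat.eq_zero_or_pos n with hn | hn
  · subst hn
    simp [h1]
    linarith
  · have e : n + 2 - 1 = n + 1 := by omega
    rw [e]
    have hI : Finset.Icc 1 (n + 1) = insert 1 (insert (n + 1) (Finset.Icc 2 n)) := by
      ext i; simp only [Finset.mem_Icc, Finset.mem_insert]; omega
    rw [hI, Finset.sum_insert (by simp; omega), Finset.sum_insert (by simp)]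
    have h2 := two_H_eq f p (by omega : 1 ≤ n + 1) (h (n + 1) (by omega))
    rw [if_neg (by omega : ¬ n + 1 = 1)] at h2
    simp only [Nat.sub_zero, pow_one, Nat.add_sub_cancel] at h2
    rw [eq_div_iff (by positivity)] at h2
    have e2 : ∑ r ∈ Finset.Icc 2 n, ((n + 2).choose r : ℝ) * (2 * Hseq f r p) *
        (2 * Hseq f (n + 2 - r) p) = 4 * ∑ r ∈ Finset.Icc 2 n, ((n + 1 + 1).choose r : ℝ) *
          Hseq f r p * Hseq f (n + 1 - r + 1) p := by
      rw [Finset.mul_sum]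
      apply Finset.sum_congr rfl
      intro r hr
      simp only [Finset.mem_Icc] at hr
      rw [show n + 2 - r = n + 1 - r + 1 by omega]
      ring
    rw [e2]
    set Sg := ∑ r ∈ Finset.Icc 2 n, ((n + 1 + 1).choose r : ℝ) *
          Hseq f r p * Hseq f (n + 1 - r + 1) p
    have e3 : (n + 2).choose (n + 1) = n + 2 := Nat.choose_succ_self_right (n + 1)
    rw [show n + 2 - 1 = n + 1 by omega, show n + 2 - (n + 1) = 1 by omega, e3, Nat.choose_one_right,
      h1]
    push_cast at h2 ⊢
    have hn2 : (n : ℝ) + 1 + 1 ≠ 0 := by positivity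
    have h3 : ((n : ℝ) + 2) * (2 * Hseq f (n + 1) p * (2 * Real.sqrt (-Kseq f 0 p))) =
        ((n : ℝ) + 2) * (-((n : ℝ) + 1) * Kseq f n p) - 4 * Sg := by
      rw [h2]; field_simp; ring
    linear_combination h3

lemma K0_pos (hflat : fxx (f 0) p * fyy (f 0) p - (fxy (f 0) p) ^ 2 ≠ 0)
    (hmin : (1 + (pdy (f 0) p) ^ 2) * fxx (f 0) p
        - 2 * pdx (f 0) p * pdy (f 0) p * fxy (f 0) p
        + (1 + (pdx (f 0) p) ^ 2) * fyy (f 0) p = 0) :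
    -Kseq f 0 p = (1 + pdx (f 0) p ^ 2 + pdy (f 0) p ^ 2) *
      (fxy (f 0) p ^ 2 - fxx (f 0) p * fyy (f 0) p) ∧ 0 < - Kseq f 0 p ∧ Hseq f 0 p = 0 := by
  have e : -Kseq f 0 p = (1 + pdx (f 0) p ^ 2 + pdy (f 0) p ^ 2) *
      (fxy (f 0) p ^ 2 - fxx (f 0) p * fyy (f 0) p) := by
    simp [Kseq, gradSqr, hessDiscr]; ring
  refine ⟨e, ?_, ?_⟩
  · rw [e]
    apply mul_pos (by positivity)
    set x := pdx (f 0) p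
    set y := pdy (f 0) p
    set A := fxx (f 0) p
    set E := fxy (f 0) p
    set D := fyy (f 0) p
    have h : (1 + y ^ 2) * (E ^ 2 - A * D) = D ^ 2 + E ^ 2 + (x * D - y * E) ^ 2 := by
      linear_combination (-D) * hmin
    have h2 : 0 ≤ (1 + y ^ 2) * (E ^ 2 - A * D) := by rw [h]; positivity
    have h3 : 0 ≤ E ^ 2 - A * D := nonneg_of_mul_nonneg_right h2 (by positivity)
    refine lt_of_le_of_ne h3 ?_
    intro h4
    apply hflat
    linarith
  · simp [Hseq, fy2r, fxfyr, fx2r]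
    linear_combination hmin

end alg

lemma C0norm_nonneg' (g : ℝ × ℝ → ℝ) (s : Set (ℝ × ℝ)) : 0 ≤ C0norm g s := by
  apply Real.sSup_nonneg
  rintro _ ⟨p, _, rfl⟩
  exact abs_nonneg _

lemma holderSemi_nonneg' (g : ℝ × ℝ → ℝ) (s : Set (ℝ × ℝ)) : 0 ≤ holderSemi g s := by
  apply Real.sSup_nonneg
  rintro _ ⟨u, _, v, _, _, rfl⟩
  positivity

lemma le_C0norm' {g : ℝ × ℝ → ℝ} {Ω : Set (ℝ × ℝ)} (hb : Bornology.IsBounded Ω)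
    (hg : ContinuousOn g (closure Ω)) : ∀ p ∈ Ω, |g p| ≤ C0norm g Ω := by
  intro p hp
  apply le_csSup
  · have hc : IsCompact (closure Ω) := hb.isCompact_closure
    have := (hc.image_of_continuousOn hg.abs).bddAbove
    exact this.mono (Set.image_mono subset_closure)
  · exact ⟨p, hp, rfl⟩

lemma le_holderSemi' {g : ℝ × ℝ → ℝ} {Ω : Set (ℝ × ℝ)} (hg : HolderHalfOn g Ω) :
    ∀ u ∈ Ω, ∀ v ∈ Ω, |g u - g v| ≤ holderSemi g Ω * ‖u - v‖ ^ ((1 : ℝ) / 2) := by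
  intro u hu v hv
  rcases eq_or_ne u v with h | h
  · subst h; simp
  · have hpos : 0 < ‖u - v‖ ^ ((1 : ℝ) / 2) :=
      Real.rpow_pos_of_pos (norm_pos_iff.mpr (sub_ne_zero.mpr h)) _
    rw [← div_le_iff₀ hpos]
    apply le_csSup
    · obtain ⟨C, hC⟩ := hg
      refine ⟨C, ?_⟩
      rintro _ ⟨u, hu, v, hv, hne, rfl⟩
      have hpos : 0 < ‖u - v‖ ^ ((1 : ℝ) / 2) :=
        Real.rpow_pos_of_pos (norm_pos_iff.mpr (sub_ne_zero.mpr hne)) _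
      rw [div_le_iff₀ hpos]
      exact hC u hu v hv
    · exact ⟨u, hu, v, hv, h, rfl⟩

structure Good (Ω : Set (ℝ × ℝ)) (g : ℝ × ℝ → ℝ) (b : ℝ) : Prop where
  nn : 0 ≤ b
  d0 : ∀ p ∈ Ω, DifferentiableAt ℝ g p
  dx : ∀ p ∈ Ω, DifferentiableAt ℝ (pdx g) p
  dy : ∀ p ∈ Ω, DifferentiableAt ℝ (pdy g) p
  b0 : ∀ p ∈ Ω, |g p| ≤ b
  bx : ∀ p ∈ Ω, |pdx g p| ≤ b
  bY : ∀ p ∈ Ω, |pdy g p| ≤ b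
  bxx : ∀ p ∈ Ω, |fxx g p| ≤ b
  bxy : ∀ p ∈ Ω, |fxy g p| ≤ b
  byy : ∀ p ∈ Ω, |fyy g p| ≤ b
  hxx : ∀ u ∈ Ω, ∀ v ∈ Ω, |fxx g u - fxx g v| ≤ b * ‖u - v‖ ^ ((1 : ℝ) / 2)
  hxy : ∀ u ∈ Ω, ∀ v ∈ Ω, |fxy g u - fxy g v| ≤ b * ‖u - v‖ ^ ((1 : ℝ) / 2)
  hyy : ∀ u ∈ Ω, ∀ v ∈ Ω, |fyy g u - fyy g v| ≤ b * ‖u - v‖ ^ ((1 : ℝ) / 2)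

lemma C2halfNorm_nonneg' (g : ℝ × ℝ → ℝ) (s : Set (ℝ × ℝ)) : 0 ≤ C2halfNorm g s := by
  unfold C2halfNorm C2norm
  have h1 := C0norm_nonneg' g s
  have h2 := le_max_of_le_left (c := C0norm (pdy g) s) (C0norm_nonneg' (pdx g) s)
  have h3 := le_max_of_le_left (c := max (C0norm (fxy g) s) (C0norm (fyy g) s))
    (C0norm_nonneg' (fxx g) s)
  have h4 := le_max_of_le_left (c := max (holderSemi (fxy g) s) (holderSemi (fyy g) s))
    (holderSemi_nonneg' (fxx g) s)
  linarith

lemma hasDeriv_x {g : ℝ × ℝ → ℝ} {p : ℝ × ℝ} (h : DifferentiableAt ℝ g p) :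
    HasDerivAt (fun s : ℝ => g (s, p.2)) (fderiv ℝ g p (1, 0)) p.1 := by
  have h1 : HasFDerivAt g (fderiv ℝ g p) ((p.1, p.2) : ℝ × ℝ) := h.hasFDerivAt
  have h2 : HasDerivAt (fun s : ℝ => ((s, p.2) : ℝ × ℝ)) (1, 0) p.1 :=
    (hasDerivAt_id p.1).prodMk (hasDerivAt_const p.1 p.2)
  exact h1.comp_hasDerivAt p.1 h2

lemma hasDeriv_y {g : ℝ × ℝ → ℝ} {p : ℝ × ℝ} (h : DifferentiableAt ℝ g p) :
    HasDerivAt (fun s : ℝ => g (p.1, s)) (fderiv ℝ g p (0, 1)) p.2 := by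
  have h1 : HasFDerivAt g (fderiv ℝ g p) ((p.1, p.2) : ℝ × ℝ) := h.hasFDerivAt
  have h2 : HasDerivAt (fun s : ℝ => ((p.1, s) : ℝ × ℝ)) (0, 1) p.2 :=
    (hasDerivAt_const p.2 p.1).prodMk (hasDerivAt_id p.2)
  exact h1.comp_hasDerivAt p.2 h2

lemma hasDeriv_pdx {g : ℝ × ℝ → ℝ} {p : ℝ × ℝ} (h : DifferentiableAt ℝ g p) :
    HasDerivAt (fun s : ℝ => g (s, p.2)) (pdx g p) p.1 :=
  (hasDeriv_x h).differentiableAt.hasDerivAt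

lemma hasDeriv_pdy {g : ℝ × ℝ → ℝ} {p : ℝ × ℝ} (h : DifferentiableAt ℝ g p) :
    HasDerivAt (fun s : ℝ => g (p.1, s)) (pdy g p) p.2 :=
  (hasDeriv_y h).differentiableAt.hasDerivAt

lemma good_of_C2Half {Ω : Set (ℝ × ℝ)} (ho : IsOpen Ω) (hb : Bornology.IsBounded Ω)
    {g : ℝ × ℝ → ℝ} (h : IsC2Half g Ω) : Good Ω g (C2halfNorm g Ω) := by
  obtain ⟨hc, c0, cx, cy, cxx, cxy, cyy, hxx, hxy, hyy⟩ := h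
  have d0 : ∀ p ∈ Ω, DifferentiableAt ℝ g p := fun p hp =>
    (hc.differentiableOn (by norm_num)).differentiableAt (ho.mem_nhds hp)
  have hfd : DifferentiableOn ℝ (fderiv ℝ g) Ω :=
    (hc.fderiv_of_isOpen ho (m := 1) (by norm_num)).differentiableOn (by norm_num)
  have n0 := C0norm_nonneg' g Ω
  have nx := C0norm_nonneg' (pdx g) Ω
  have ny := C0norm_nonneg' (pdy g) Ω
  have nxx := C0norm_nonneg' (fxx g) Ω
  have nxy := C0norm_nonneg' (fxy g) Ω
  have nyy := C0norm_nonneg' (fyy g) Ω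
  have mxx := holderSemi_nonneg' (fxx g) Ω
  have mxy := holderSemi_nonneg' (fxy g) Ω
  have myy := holderSemi_nonneg' (fyy g) Ω
  have k1 := le_max_left (C0norm (pdx g) Ω) (C0norm (pdy g) Ω)
  have k2 := le_max_right (C0norm (pdx g) Ω) (C0norm (pdy g) Ω)
  have k3 := le_max_left (C0norm (fxx g) Ω) (max (C0norm (fxy g) Ω) (C0norm (fyy g) Ω))
  have k4 := le_max_right (C0norm (fxx g) Ω) (max (C0norm (fxy g) Ω) (C0norm (fyy g) Ω))
  have k5 := le_max_left (C0norm (fxy g) Ω) (C0norm (fyy g) Ω)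
  have k6 := le_max_right (C0norm (fxy g) Ω) (C0norm (fyy g) Ω)
  have l3 := le_max_left (holderSemi (fxx g) Ω) (max (holderSemi (fxy g) Ω) (holderSemi (fyy g) Ω))
  have l4 := le_max_right (holderSemi (fxx g) Ω) (max (holderSemi (fxy g) Ω) (holderSemi (fyy g) Ω))
  have l5 := le_max_left (holderSemi (fxy g) Ω) (holderSemi (fyy g) Ω)
  have l6 := le_max_right (holderSemi (fxy g) Ω) (holderSemi (fyy g) Ω)
  have hdef : C2halfNorm g Ω = C0norm g Ω + max (C0norm (pdx g) Ω) (C0norm (pdy g) Ω)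
    + max (C0norm (fxx g) Ω) (max (C0norm (fxy g) Ω) (C0norm (fyy g) Ω))
    + max (holderSemi (fxx g) Ω) (max (holderSemi (fxy g) Ω) (holderSemi (fyy g) Ω)) := rfl
  refine ⟨C2halfNorm_nonneg' g Ω, d0, ?_, ?_, ?_, ?_, ?_, ?_, ?_, ?_, ?_, ?_, ?_⟩
  · intro p hp
    have e : pdx g =ᶠ[𝓝 p] fun q => fderiv ℝ g q (1, 0) := by
      filter_upwards [ho.mem_nhds hp] with q hq
      exact (hasDeriv_x (d0 q hq)).deriv
    rw [e.differentiableAt_iff]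
    exact (hfd.differentiableAt (ho.mem_nhds hp)).clm_apply (differentiableAt_const _)
  · intro p hp
    have e : pdy g =ᶠ[𝓝 p] fun q => fderiv ℝ g q (0, 1) := by
      filter_upwards [ho.mem_nhds hp] with q hq
      exact (hasDeriv_y (d0 q hq)).deriv
    rw [e.differentiableAt_iff]
    exact (hfd.differentiableAt (ho.mem_nhds hp)).clm_apply (differentiableAt_const _)
  · intro p hp
    exact (le_C0norm' hb c0 p hp).trans (by linarith)
  · intro p hp
    exact (le_C0norm' hb cx p hp).trans (by linarith)
  · intro p hp
    exact (le_C0norm' hb cy p hp).trans (by linarith)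
  · intro p hp
    exact (le_C0norm' hb cxx p hp).trans (by linarith)
  · intro p hp
    exact (le_C0norm' hb cxy p hp).trans (by linarith)
  · intro p hp
    exact (le_C0norm' hb cyy p hp).trans (by linarith)
  · intro u hu v hv
    refine (le_holderSemi' hxx u hu v hv).trans ?_
    gcongr
    linarith
  · intro u hu v hv
    refine (le_holderSemi' hxy u hu v hv).trans ?_
    gcongr
    linarith
  · intro u hu v hv
    refine (le_holderSemi' hyy u hu v hv).trans ?_
    gcongr
    linarith

lemma C0norm_le' {g : ℝ × ℝ → ℝ} {Ω : Set (ℝ × ℝ)} {b : ℝ} (hb : 0 ≤ b)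
    (h : ∀ p ∈ Ω, |g p| ≤ b) : C0norm g Ω ≤ b := by
  apply Real.sSup_le _ hb
  rintro _ ⟨p, hp, rfl⟩
  exact h p hp

lemma holderSemi_le' {g : ℝ × ℝ → ℝ} {Ω : Set (ℝ × ℝ)} {b : ℝ} (hb : 0 ≤ b)
    (h : ∀ u ∈ Ω, ∀ v ∈ Ω, |g u - g v| ≤ b * ‖u - v‖ ^ ((1 : ℝ) / 2)) : holderSemi g Ω ≤ b := by
  apply Real.sSup_le _ hb
  rintro _ ⟨u, hu, v, hv, hne, rfl⟩
  have hpos : 0 < ‖u - v‖ ^ ((1 : ℝ) / 2) :=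
    Real.rpow_pos_of_pos (norm_pos_iff.mpr (sub_ne_zero.mpr hne)) _
  rw [div_le_iff₀ hpos]
  exact h u hu v hv

section series
variable {Ω : Set (ℝ × ℝ)} {g : ℕ → ℝ × ℝ → ℝ} {b c : ℕ → ℝ}

lemma term_le {x B d : ℝ} (h : |x| ≤ B) : ‖x * d‖ ≤ B * |d| := by
  rw [Real.norm_eq_abs, abs_mul]; gcongr

lemma pdx_tsum (ho : IsOpen Ω) (hd : ∀ m, ∀ p ∈ Ω, DifferentiableAt ℝ (g m) p)
    (hb : ∀ m, ∀ p ∈ Ω, |g m p| ≤ b m) (hb' : ∀ m, ∀ p ∈ Ω, |pdx (g m) p| ≤ b m)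
    (hs : Summable (fun m => b m * |c m|)) {F : ℝ × ℝ → ℝ}
    (hF : ∀ p ∈ Ω, F p = ∑' m, g m p * c m) :
    ∀ p ∈ Ω, pdx F p = ∑' m, pdx (g m) p * c m := by
  intro p hp
  obtain ⟨r, hr, hball⟩ := Metric.isOpen_iff.mp ho p hp
  have hin : ∀ z ∈ Metric.ball p.1 r, (z, p.2) ∈ Ω := by
    intro z hz
    apply hball
    rw [Metric.mem_ball, Prod.dist_eq]
    exact max_lt hz (by simpa using hr)
  have hp1 : p.1 ∈ Metric.ball p.1 r := Metric.mem_ball_self hr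
  have key := hasDerivAt_tsum_of_isPreconnected (g := fun m z => g m (z, p.2) * c m)
    (g' := fun m z => pdx (g m) (z, p.2) * c m) hs Metric.isOpen_ball
    (convex_ball p.1 r).isPreconnected
    (fun m z hz => (hasDeriv_pdx (hd m (z, p.2) (hin z hz))).mul_const (c m))
    (fun m z hz => term_le (hb' m _ (hin z hz))) hp1
    (Summable.of_norm_bounded hs (fun m => term_le (hb m _ (hin _ hp1)))) hp1
  have e : (fun s => F (s, p.2)) =ᶠ[𝓝 p.1] fun z => ∑' m, g m (z, p.2) * c m := by
    filter_upwards [Metric.ball_mem_nhds p.1 hr] with z hz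
    exact hF _ (hin z hz)
  exact (key.congr_of_eventuallyEq e).deriv

lemma pdy_tsum (ho : IsOpen Ω) (hd : ∀ m, ∀ p ∈ Ω, DifferentiableAt ℝ (g m) p)
    (hb : ∀ m, ∀ p ∈ Ω, |g m p| ≤ b m) (hb' : ∀ m, ∀ p ∈ Ω, |pdy (g m) p| ≤ b m)
    (hs : Summable (fun m => b m * |c m|)) {F : ℝ × ℝ → ℝ}
    (hF : ∀ p ∈ Ω, F p = ∑' m, g m p * c m) :
    ∀ p ∈ Ω, pdy F p = ∑' m, pdy (g m) p * c m := by
  intro p hp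
  obtain ⟨r, hr, hball⟩ := Metric.isOpen_iff.mp ho p hp
  have hin : ∀ z ∈ Metric.ball p.2 r, (p.1, z) ∈ Ω := by
    intro z hz
    apply hball
    rw [Metric.mem_ball, Prod.dist_eq]
    exact max_lt (by simpa using hr) hz
  have hp1 : p.2 ∈ Metric.ball p.2 r := Metric.mem_ball_self hr
  have key := hasDerivAt_tsum_of_isPreconnected (g := fun m z => g m (p.1, z) * c m)
    (g' := fun m z => pdy (g m) (p.1, z) * c m) hs Metric.isOpen_ball
    (convex_ball p.2 r).isPreconnected
    (fun m z hz => (hasDeriv_pdy (hd m (p.1, z) (hin z hz))).mul_const (c m))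
    (fun m z hz => term_le (hb' m _ (hin z hz))) hp1
    (Summable.of_norm_bounded hs (fun m => term_le (hb m _ (hin _ hp1)))) hp1
  have e : (fun s => F (p.1, s)) =ᶠ[𝓝 p.2] fun z => ∑' m, g m (p.1, z) * c m := by
    filter_upwards [Metric.ball_mem_nhds p.2 hr] with z hz
    exact hF _ (hin z hz)
  exact (key.congr_of_eventuallyEq e).deriv

lemma series_derivs (ho : IsOpen Ω) (hg : ∀ m, Good Ω (g m) (b m))
    (hs : Summable (fun m => b m * |c m|)) {F : ℝ × ℝ → ℝ}
    (hF : ∀ p ∈ Ω, F p = ∑' m, g m p * c m) :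
    (∀ p ∈ Ω, pdx F p = ∑' m, pdx (g m) p * c m) ∧
    (∀ p ∈ Ω, pdy F p = ∑' m, pdy (g m) p * c m) ∧
    (∀ p ∈ Ω, fxx F p = ∑' m, fxx (g m) p * c m) ∧
    (∀ p ∈ Ω, fxy F p = ∑' m, fxy (g m) p * c m) ∧
    (∀ p ∈ Ω, fyy F p = ∑' m, fyy (g m) p * c m) := by
  have hx := pdx_tsum ho (fun m => (hg m).d0) (fun m => (hg m).b0) (fun m => (hg m).bx) hs hF
  have hy := pdy_tsum ho (fun m => (hg m).d0) (fun m => (hg m).b0) (fun m => (hg m).bY) hs hF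
  exact ⟨hx, hy,
    pdx_tsum ho (fun m => (hg m).dx) (fun m => (hg m).bx) (fun m => (hg m).bxx) hs hx,
    pdy_tsum ho (fun m => (hg m).dx) (fun m => (hg m).bx) (fun m => (hg m).bxy) hs hx,
    pdy_tsum ho (fun m => (hg m).dy) (fun m => (hg m).bY) (fun m => (hg m).byy) hs hy⟩

lemma abs_series_le (hs : Summable (fun m => b m * |c m|)) {x : ℕ → ℝ} (hx : ∀ m, |x m| ≤ b m) :
    |∑' m, x m * c m| ≤ ∑' m, b m * |c m| := by
  rw [← Real.norm_eq_abs]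
  exact tsum_of_norm_bounded hs.hasSum (fun m => term_le (hx m))

lemma abs_series_sub_le (hs : Summable (fun m => b m * |c m|)) {x y : ℕ → ℝ} {d : ℝ}
    (hx : ∀ m, |x m| ≤ b m) (hy : ∀ m, |y m| ≤ b m) (hxy : ∀ m, |x m - y m| ≤ b m * d) :
    |∑' m, x m * c m - ∑' m, y m * c m| ≤ (∑' m, b m * |c m|) * d := by
  have sx : Summable (fun m => x m * c m) := Summable.of_norm_bounded hs (fun m => term_le (hx m))
  have sy : Summable (fun m => y m * c m) := Summable.of_norm_bounded hs (fun m => term_le (hy m))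
  rw [← sx.tsum_sub sy, ← Real.norm_eq_abs]
  refine tsum_of_norm_bounded (hs.hasSum.mul_right d) (fun m => ?_)
  rw [← sub_mul]
  refine (term_le (hxy m)).trans (le_of_eq ?_)
  ring

lemma series_norm_le (ho : IsOpen Ω) (hg : ∀ m, Good Ω (g m) (b m))
    (hs : Summable (fun m => b m * |c m|)) {F : ℝ × ℝ → ℝ}
    (hF : ∀ p ∈ Ω, F p = ∑' m, g m p * c m) :
    C2halfNorm F Ω ≤ 4 * ∑' m, b m * |c m| := by
  obtain ⟨hx, hy, hxx, hxy, hyy⟩ := series_derivs ho hg hs hF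
  set T := ∑' m, b m * |c m|
  have hT : 0 ≤ T := tsum_nonneg (fun m => mul_nonneg (hg m).nn (abs_nonneg _))
  have a0 : C0norm F Ω ≤ T := C0norm_le' hT (fun p hp => by
    rw [hF p hp]; exact abs_series_le hs (fun m => (hg m).b0 p hp))
  have ax : C0norm (pdx F) Ω ≤ T := C0norm_le' hT (fun p hp => by
    rw [hx p hp]; exact abs_series_le hs (fun m => (hg m).bx p hp))
  have ay : C0norm (pdy F) Ω ≤ T := C0norm_le' hT (fun p hp => by
    rw [hy p hp]; exact abs_series_le hs (fun m => (hg m).bY p hp))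
  have axx : C0norm (fxx F) Ω ≤ T := C0norm_le' hT (fun p hp => by
    rw [hxx p hp]; exact abs_series_le hs (fun m => (hg m).bxx p hp))
  have axy : C0norm (fxy F) Ω ≤ T := C0norm_le' hT (fun p hp => by
    rw [hxy p hp]; exact abs_series_le hs (fun m => (hg m).bxy p hp))
  have ayy : C0norm (fyy F) Ω ≤ T := C0norm_le' hT (fun p hp => by
    rw [hyy p hp]; exact abs_series_le hs (fun m => (hg m).byy p hp))
  have sxx : holderSemi (fxx F) Ω ≤ T := holderSemi_le' hT (fun u hu v hv => by
    rw [hxx u hu, hxx v hv]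
    exact abs_series_sub_le hs (fun m => (hg m).bxx u hu) (fun m => (hg m).bxx v hv)
      (fun m => (hg m).hxx u hu v hv))
  have sxy : holderSemi (fxy F) Ω ≤ T := holderSemi_le' hT (fun u hu v hv => by
    rw [hxy u hu, hxy v hv]
    exact abs_series_sub_le hs (fun m => (hg m).bxy u hu) (fun m => (hg m).bxy v hv)
      (fun m => (hg m).hxy u hu v hv))
  have syy : holderSemi (fyy F) Ω ≤ T := holderSemi_le' hT (fun u hu v hv => by
    rw [hyy u hu, hyy v hv]
    exact abs_series_sub_le hs (fun m => (hg m).byy u hu) (fun m => (hg m).byy v hv)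
      (fun m => (hg m).hyy u hu v hv))
  unfold C2halfNorm C2norm
  have m1 := max_le ax ay
  have m2 := max_le axx (max_le axy ayy)
  have m3 := max_le sxx (max_le sxy syy)
  linarith

end series

/-- Majorization of the solutions of the recursive linear elliptic
system by the Euclidean majorant sequence, and convergence of the resulting series in
the `C^{2+1/2}` norm to a solution of the Euclidean CRPC equation for all small `t`. -/
theorem stmt_16 (Ω : Set (ℝ × ℝ)) (hΩ : IsAnalyticJordanDomain Ω)
    (f : ℕ → ℝ × ℝ → ℝ)
    (hf0 : IsC2Half (f 0) Ω)
    (hflat : ∀ p ∈ closure Ω, fxx (f 0) p * fyy (f 0) p - (fxy (f 0) p) ^ 2 ≠ 0)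
    (hmin : ∀ p ∈ closure Ω,
      (1 + (pdy (f 0) p) ^ 2) * fxx (f 0) p
        - 2 * pdx (f 0) p * pdy (f 0) p * fxy (f 0) p
        + (1 + (pdx (f 0) p) ^ 2) * fyy (f 0) p = 0)
    (hseq : ∀ m : ℕ, 1 ≤ m → IsC2Half (f m) Ω ∧ (∀ p ∈ frontier Ω, f m p = 0) ∧
      ∀ p ∈ Ω, Hop f 0 (f m) p = ellipticRHS f m p)
    (CΩ : ℝ) (hCΩ : 0 < CΩ)
    (hbound : ∀ m : ℕ, 1 ≤ m →
      C2halfNorm (f m) Ω ≤ CΩ *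
        (multinom3Sum (fun k => C2halfNorm (f k) Ω) m
          + (m : ℝ) * multinom4Sum (fun k => C2halfNorm (f k) Ω) m
          + 1 / ((m : ℝ) + 1) * multinom6Sum (fun k => C2halfNorm (f k) Ω) m))
    (a : ℕ → ℝ)
    (ha0 : a 0 = C2halfNorm (f 0) Ω)
    (ha : ∀ m : ℕ, 1 ≤ m → a m =
      CΩ * multinom3Sum a m + CΩ * (m : ℝ) * multinom4Sum a m
        + CΩ / ((m : ℝ) + 1) * multinom6Sum a m) :
    (∀ m : ℕ, C2halfNorm (f m) Ω ≤ a m) ∧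
    ∃ ε > (0 : ℝ), ∀ t : ℝ, |t| < ε →
      (∀ p ∈ closure Ω, Summable (fun m : ℕ => f m p * t ^ m / (m.factorial : ℝ))) ∧
      Tendsto (fun n : ℕ => C2halfNorm
          (fun p => (∑' m : ℕ, f m p * t ^ m / (m.factorial : ℝ))
            - ∑ m ∈ Finset.range n, f m p * t ^ m / (m.factorial : ℝ)) Ω)
        atTop (𝓝 0) ∧
      ∀ p ∈ Ω, EuclideanCRPCAt t
        (fun q => ∑' m : ℕ, f m q * t ^ m / (m.factorial : ℝ)) p := by
  obtain ⟨ho, hbd, hconn, -⟩ := hΩ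
  have hC2 : ∀ m, IsC2Half (f m) Ω := by
    intro m
    rcases Nat.eq_zero_or_pos m with h | h
    · subst h; exact hf0
    · exact (hseq m h).1
  set b : ℕ → ℝ := fun k => C2halfNorm (f k) Ω with hbdef
  have hb0 : ∀ k, 0 ≤ b k := fun k => C2halfNorm_nonneg' _ _
  have hba : ∀ m, b m ≤ a m := major_bound CΩ hCΩ b a hb0 hbound ha0 ha
  refine ⟨hba, ?_⟩
  have hgood : ∀ m, Good Ω (f m) (b m) := fun m => good_of_C2Half ho hbd (hC2 m)
  obtain ⟨B, R, hB, hR, hgrow⟩ := major_growth hCΩ (fun k => (hb0 k).trans (hba k)) ha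
  have hbg : ∀ m, b m ≤ (m.factorial : ℝ) * (B * R ^ m) := fun m => (hba m).trans (hgrow m)
  have hbGB : GB B R b := fun m => by rw [abs_of_nonneg (hb0 m)]; exact hbg m
  -- lower bound of -K0
  obtain ⟨κ, hκ, hκK⟩ : ∃ κ > 0, ∀ p ∈ closure Ω, κ ≤ - Kseq f 0 p := by
    have hc : IsCompact (closure Ω) := hbd.isCompact_closure
    have hne : (closure Ω).Nonempty := hconn.nonempty.closure
    obtain ⟨-, -, cx, cy, cxx, cxy, cyy, -⟩ := hf0
    have hcont : ContinuousOn (fun p => (1 + pdx (f 0) p ^ 2 + pdy (f 0) p ^ 2) *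
      (fxy (f 0) p ^ 2 - fxx (f 0) p * fyy (f 0) p)) (closure Ω) :=
      ((continuousOn_const.add (cx.pow 2)).add (cy.pow 2)).mul ((cxy.pow 2).sub (cxx.mul cyy))
    obtain ⟨q, hq, hmn⟩ := hc.exists_isMinOn hne hcont
    have hK := fun p hp => K0_pos f p (hflat p hp) (hmin p hp)
    refine ⟨- Kseq f 0 q, (hK q hq).2.1, ?_⟩
    intro p hp
    rw [(hK p hp).1, (hK q hq).1]
    exact hmn hp
  set δ := Real.sqrt κ with hδ
  have hδ0 : 0 < δ := Real.sqrt_pos.mpr hκ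
  set C := 2 * ((1 + B * B) * B) + 2 * (B * B * B) with hC
  have hC0 : 0 ≤ C := by positivity
  have hR0 : 0 < R := by linarith
  refine ⟨min (1 / (8 * R)) (δ / (2 * C * (4 * R) ^ 2 + 1)), by positivity, ?_⟩
  intro t ht
  have ht1 : |t| * (4 * R) ≤ 1 / 2 := by
    have h := (lt_of_lt_of_le ht (min_le_left _ _)).le
    rw [le_div_iff₀ (by positivity)] at h
    linarith
  have ht2 : 2 * C * (4 * R) ^ 2 * |t| ≤ δ := by
    have h := (lt_of_lt_of_le ht (min_le_right _ _)).le
    rw [le_div_iff₀ (by positivity)] at h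
    have := abs_nonneg t
    linarith
  have ht4 : |t| * (4 * R) < 1 := by linarith
  have htR : |t| * R < 1 := by
    have := mul_nonneg (abs_nonneg t) hR0.le
    linarith
  set c : ℕ → ℝ := fun m => t ^ m / (m.factorial : ℝ) with hc
  have hfc : ∀ (x : ℝ) (m : ℕ), x * t ^ m / (m.factorial : ℝ) = x * c m := by
    intro x m; rw [hc]; ring
  have hs : Summable (fun m => b m * |c m|) := by
    refine (hbGB.summable hR htR).congr (fun m => ?_)
    rw [hfc, Real.norm_eq_abs, abs_mul, abs_of_nonneg (hb0 m)]
  have hbcl : ∀ m, ∀ p ∈ closure Ω, |f m p| ≤ b m := by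
    intro m p hp
    exact le_on_closure (hgood m).b0 (hC2 m).2.1.abs continuousOn_const hp
  have hsum : ∀ p ∈ closure Ω, Summable (fun m => f m p * c m) := fun p hp =>
    Summable.of_norm_bounded hs (fun m => term_le (hbcl m p hp))
  simp only [hfc]
  refine ⟨hsum, ?_, ?_⟩
  · have hle : ∀ n, C2halfNorm (fun p => (∑' m, f m p * c m) - ∑ m ∈ Finset.range n, f m p * c m) Ω
        ≤ 4 * ∑' m, b (m + n) * |c (m + n)| := by
      intro n
      refine series_norm_le (g := fun m => f (m + n)) (b := fun m => b (m + n))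
        (c := fun m => c (m + n)) ho (fun m => hgood (m + n))
        ((summable_nat_add_iff (f := fun m => b m * |c m|) n).mpr hs) ?_
      intro p hp
      have := (hsum p (subset_closure hp)).sum_add_tsum_nat_add n
      linarith
    have hlim : Tendsto (fun n => 4 * ∑' m, b (m + n) * |c (m + n)|) atTop (𝓝 0) := by
      have := (tendsto_sum_nat_add (fun m => b m * |c m|)).const_mul 4
      simpa using this
    exact squeeze_zero (fun n => C2halfNorm_nonneg' _ _) hle hlim
  · intro p hp
    obtain ⟨ex, ey, exx, exy, eyy⟩ := series_derivs ho hgood hs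
      (F := fun q => ∑' m, f m q * c m) (fun q _ => rfl)
    have eg : ∀ u : ℕ → ℝ, ∑' m, u m * c m = egf u t := fun u =>
      tsum_congr (fun m => (hfc (u m) m).symm)
    unfold EuclideanCRPCAt
    rw [ex p hp, ey p hp, exx p hp, exy p hp, eyy p hp, eg (fun m => pdx (f m) p),
      eg (fun m => pdy (f m) p), eg (fun m => fxx (f m) p), eg (fun m => fxy (f m) p),
      eg (fun m => fyy (f m) p)]
    have gX : GB B R (fun m => pdx (f m) p) := fun m => ((hgood m).bx p hp).trans (hbg m)
    have gY : GB B R (fun m => pdy (f m) p) := fun m => ((hgood m).bY p hp).trans (hbg m)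
    have gA : GB B R (fun m => fxx (f m) p) := fun m => ((hgood m).bxx p hp).trans (hbg m)
    have gE : GB B R (fun m => fxy (f m) p) := fun m => ((hgood m).bxy p hp).trans (hbg m)
    have gD : GB B R (fun m => fyy (f m) p) := fun m => ((hgood m).byy p hp).trans (hbg m)
    obtain ⟨C', -, hC', gH, eH⟩ := egf_HH hB hR gX gY gA gE gD
    rw [← hC] at hC'
    rw [hC'] at gH
    have hHf := funext (HH_eq f p)
    rw [← eH t ht4, ← egf_KK hB hR gX gY gA gE gD t ht4]
    rw [hHf] at gH ⊢
    have hKf := funext (KK_eq f p)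
    rw [hKf]
    have hpc := subset_closure hp
    obtain ⟨-, hKpos, hH0⟩ := K0_pos f p (hflat p hpc) (hmin p hpc)
    obtain ⟨h1, hconv⟩ := H_conv f p hKpos hH0 (fun m hm => (hseq m hm).2.2 p hp)
    refine egf_sqrt hC0 (by linarith) hδ0 gH (by simp [hH0]) ?_ hconv ht1 ht2
    rw [h1, hδ]
    exact Real.sqrt_le_sqrt (hκK p hpc)

end
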